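/- arXiv:2008.12222 — 2 statements merged into one kernel-verified Lean document; each statement's English description precedes it below -/
import Mathlib

section
/- For all γ > 0 there exists n₀ = n₀(γ) ∈ ℕ such that for every n ≥ n₀ with n divisible by 3 and every t with 1 ≤ t ≤ (1 − √(2/3))·n, the following holds. Suppose H is a 3-graph on n vertices with degree sequence d₁ ≤ … ≤ dₙ such that dᵢ ≥ (1/3 + γ)·C(n,2) + i·t for 1 ≤ i ≤ t, dᵢ ≥ (4/9 + γ)·C(n,2) for t < i ≤ n/3, and dᵢ ≥ (5/9 + γ)·C(n,2) for i > n/3. Then H contains a perfect matching. -/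
open Finset
open scoped Classical

noncomputable section

/-- The degree of a vertex `v` in a `3`-graph `H` on `Fin n`. -/
def deg {n : ℕ} (H : Finset (Finset (Fin n))) (v : Fin n) : ℕ :=
  (H.filter fun e => v ∈ e).card

/-- `H` is a `3`-graph: every edge has exactly three vertices. -/
def Is3Graph (n : ℕ) (H : Finset (Finset (Fin n))) : Prop :=
  ∀ e ∈ H, e.card = 3

/-- `M` is a matching in `H`. -/
def IsMatching {n : ℕ} (H M : Finset (Finset (Fin n))) : Prop :=
  M ⊆ H ∧ ∀ e ∈ M, ∀ f ∈ M, e ≠ f → Disjoint e f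

/-- The set of vertices covered by a collection `M` of edges. -/
def cover {n : ℕ} (M : Finset (Finset (Fin n))) : Finset (Fin n) :=
  M.biUnion id

/-- `M` is a perfect matching in `H`. -/
def IsPerfectMatching {n : ℕ} (H M : Finset (Finset (Fin n))) : Prop :=
  IsMatching H M ∧ cover M = univ

/-- The number of pairs `(i, j)` with `e i + f j ≥ 1 - c`. -/
def heavyPairs (c : ℝ) (e f : Fin 3 → ℝ) : ℝ :=
  ∑ i, ∑ j, if 1 ≤ c + e i + f j then 1 else 0

/-- The number of coordinates of `e` below `b`. -/
def lightCount (b : ℝ) (e : Fin 3 → ℝ) : ℝ := ∑ i, if e i < b then 1 else 0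

/-- `0` if at least two coordinates of `e` are equal to `1 / 2` and `1` otherwise. -/
def halfDefect (e : Fin 3 → ℝ) : ℝ := if 2 ≤ ∑ i, (if e i = 1 / 2 then (1 : ℝ) else 0) then 0 else 1

lemma heavyPairs_comp (c : ℝ) (e f : Fin 3 → ℝ) (σ τ : Equiv.Perm (Fin 3)) :
    heavyPairs c (e ∘ σ) (f ∘ τ) = heavyPairs c e f := by
  unfold heavyPairs
  rw [← Equiv.sum_comp σ fun i => ∑ j, if 1 ≤ c + e i + f j then (1 : ℝ) else 0]
  exact Finset.sum_congr rfl fun i _ =>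
    Equiv.sum_comp τ fun j => if 1 ≤ c + e (σ i) + f j then (1 : ℝ) else 0

lemma lightCount_comp (b : ℝ) (e : Fin 3 → ℝ) (σ : Equiv.Perm (Fin 3)) :
    lightCount b (e ∘ σ) = lightCount b e :=
  Equiv.sum_comp σ fun i => if e i < b then (1 : ℝ) else 0

lemma halfDefect_comp (e : Fin 3 → ℝ) (σ : Equiv.Perm (Fin 3)) :
    halfDefect (e ∘ σ) = halfDefect e := by
  unfold halfDefect
  rw [← Equiv.sum_comp σ fun i => if e i = 1 / 2 then (1 : ℝ) else 0]
  rfl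

/-- A triple of weights: nonnegative with sum at most `1`. -/
def IsWeightTriple (e : Fin 3 → ℝ) : Prop := (∀ i, 0 ≤ e i) ∧ ∑ i, e i ≤ 1

lemma IsWeightTriple.exists_sorted {e : Fin 3 → ℝ} (he : IsWeightTriple e) :
    ∃ σ : Equiv.Perm (Fin 3), 0 ≤ (e ∘ σ) 0 ∧ (e ∘ σ) 0 ≤ (e ∘ σ) 1 ∧
      (e ∘ σ) 1 ≤ (e ∘ σ) 2 ∧ (e ∘ σ) 0 + (e ∘ σ) 1 + (e ∘ σ) 2 ≤ 1 := by
  refine ⟨Tuple.sort e, he.1 _, Tuple.monotone_sort e (by decide),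
    Tuple.monotone_sort e (by decide), ?_⟩
  have h := he.2
  rw [← Equiv.sum_comp (Tuple.sort e), Fin.sum_univ_three] at h
  exact h

lemma heavyPairs_zero_le_five {e f : Fin 3 → ℝ} (he : IsWeightTriple e) (hf : IsWeightTriple f) :
    heavyPairs 0 e f ≤ 5 := by
  obtain ⟨σ, h1, h2, h3, h4⟩ := he.exists_sorted
  obtain ⟨τ, k1, k2, k3, k4⟩ := hf.exists_sorted
  rw [← heavyPairs_comp 0 e f σ τ]
  generalize e ∘ σ = e at *
  generalize f ∘ τ = f at *
  simp only [heavyPairs, Fin.sum_univ_three]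
  generalize e 0 = x at *; generalize e 1 = y at *; generalize e 2 = z at *
  generalize f 0 = x' at *; generalize f 1 = y' at *; generalize f 2 = z' at *
  have h00 : ¬ 1 ≤ 0 + x + x' := by linarith
  have h01 : ¬ 1 ≤ 0 + x + y' := by linarith
  have h10 : ¬ 1 ≤ 0 + y + x' := by linarith
  simp only [h00, h01, h10, if_false]
  grind (splits := 30)

lemma two_mul_heavyPairs_le {b : ℝ} (hb : 0 < b) {e f : Fin 3 → ℝ} (he : IsWeightTriple e)
    (hf : IsWeightTriple f) : 2 * heavyPairs 0 e f ≤ 6 + lightCount b e + lightCount b f := by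
  obtain ⟨σ, h1, h2, h3, h4⟩ := he.exists_sorted
  obtain ⟨τ, k1, k2, k3, k4⟩ := hf.exists_sorted
  rw [← heavyPairs_comp 0 e f σ τ, ← lightCount_comp b e σ, ← lightCount_comp b f τ]
  generalize e ∘ σ = e at *
  generalize f ∘ τ = f at *
  simp only [heavyPairs, lightCount, Fin.sum_univ_three]
  generalize e 0 = x at *; generalize e 1 = y at *; generalize e 2 = z at *
  generalize f 0 = x' at *; generalize f 1 = y' at *; generalize f 2 = z' at *
  have h00 : ¬ 1 ≤ 0 + x + x' := by linarith
  have h01 : ¬ 1 ≤ 0 + x + y' := by linarith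
  have h10 : ¬ 1 ≤ 0 + y + x' := by linarith
  simp only [h00, h01, h10, if_false]
  grind (splits := 30)

lemma halfDefect_of_sorted {e : Fin 3 → ℝ} (h0 : 0 ≤ e 0) (h1 : e 0 ≤ e 1) (h2 : e 1 ≤ e 2)
    (h : e 0 + e 1 + e 2 ≤ 1) :
    halfDefect e = if e 1 = 1 / 2 ∧ e 2 = 1 / 2 then 0 else 1 := by
  simp only [halfDefect, Fin.sum_univ_three]
  grind

lemma heavyPairs_add_heavyPairs_le {b : ℝ} (hb : 0 < b) (hb' : b < 1 / 3) {e f : Fin 3 → ℝ}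
    (he : IsWeightTriple e) (hf : IsWeightTriple f) :
    heavyPairs 0 e f + heavyPairs b e f ≤
      8 + halfDefect f * (lightCount b e - 1) + halfDefect e * (lightCount b f - 1) := by
  obtain ⟨σ, h1, h2, h3, h4⟩ := he.exists_sorted
  obtain ⟨τ, k1, k2, k3, k4⟩ := hf.exists_sorted
  rw [← heavyPairs_comp 0 e f σ τ, ← heavyPairs_comp b e f σ τ, ← lightCount_comp b e σ,
    ← lightCount_comp b f τ, ← halfDefect_comp e σ, ← halfDefect_comp f τ]
  rw [halfDefect_of_sorted h1 h2 h3 h4, halfDefect_of_sorted k1 k2 k3 k4]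
  generalize e ∘ σ = e at *
  generalize f ∘ τ = f at *
  simp only [heavyPairs, lightCount, Fin.sum_univ_three]
  generalize e 0 = x at *; generalize e 1 = y at *; generalize e 2 = z at *
  generalize f 0 = x' at *; generalize f 1 = y' at *; generalize f 2 = z' at *
  have h00 : ¬ 1 ≤ 0 + x + x' := by linarith
  have h01 : ¬ 1 ≤ 0 + x + y' := by linarith
  have h10 : ¬ 1 ≤ 0 + y + x' := by linarith
  have hb00 : ¬ 1 ≤ b + x + x' := by linarith
  simp only [h00, h01, h10, hb00, if_false]
  by_cases hP : y = 1 / 2 ∧ z = 1 / 2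
  · obtain ⟨rfl, rfl⟩ := hP
    obtain rfl : x = 0 := by linarith
    have hb2 : ¬ (1 / 2 : ℝ) < b := by linarith
    simp only [hb2, hb, if_true, if_false, and_self, zero_mul]
    by_cases hP' : y' = 1 / 2 ∧ z' = 1 / 2
    · obtain ⟨rfl, rfl⟩ := hP'
      obtain rfl : x' = 0 := by linarith
      grind (splits := 40)
    · simp only [hP', if_false]
      grind (splits := 40)
  by_cases hP' : y' = 1 / 2 ∧ z' = 1 / 2
  · obtain ⟨rfl, rfl⟩ := hP'
    obtain rfl : x' = 0 := by linarith
    have hb2 : ¬ (1 / 2 : ℝ) < b := by linarith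
    simp only [hb2, hb, hP, if_true, if_false, and_self, zero_mul]
    grind (splits := 40)
  simp only [hP, hP', if_false, one_mul]
  rcases lt_or_ge z b with hz | hz
  · have hx : x < b := by linarith
    have hy : y < b := by linarith
    have h11 : ¬ 1 ≤ 0 + y + y' := by linarith
    have h20 : ¬ 1 ≤ 0 + z + x' := by linarith
    have h21 : ¬ 1 ≤ 0 + z + y' := by linarith
    have hb10 : ¬ 1 ≤ b + y + x' := by linarith
    have hb20 : ¬ 1 ≤ b + z + x' := by linarith
    simp only [hx, hy, hz, h11, h20, h21, hb10, hb20, if_true, if_false]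
    grind (splits := 40)
  rcases lt_or_ge z' b with hz' | hz'
  · have hx : x' < b := by linarith
    have hy : y' < b := by linarith
    have h11 : ¬ 1 ≤ 0 + y + y' := by linarith
    have h20 : ¬ 1 ≤ 0 + x + z' := by linarith
    have h21 : ¬ 1 ≤ 0 + y + z' := by linarith
    have hb10 : ¬ 1 ≤ b + x + y' := by linarith
    have hb20 : ¬ 1 ≤ b + x + z' := by linarith
    simp only [hx, hy, hz', h11, h20, h21, hb10, hb20, if_true, if_false]
    grind (splits := 40)
  simp only [hz.not_gt, hz'.not_gt, if_false]
  rcases lt_or_ge y b with hy | hy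
  · have hx : x < b := by linarith
    have h11 : ¬ 1 ≤ 0 + y + y' := by linarith
    have hb10 : ¬ 1 ≤ b + y + x' := by linarith
    simp only [hx, hy, h11, hb10, if_true, if_false]
    rcases lt_or_ge y' b with hy' | hy'
    · have hx : x' < b := by linarith
      have hb11 : ¬ 1 ≤ b + y + y' := by linarith
      have hb01 : ¬ 1 ≤ b + x + y' := by linarith
      simp only [hx, hy', hb11, hb01, if_true, if_false]
      grind (splits := 40)
    · simp only [hy'.not_gt, if_false]
      grind (splits := 40)
  rcases lt_or_ge y' b with hy' | hy'
  · have hx : x' < b := by linarith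
    have h11 : ¬ 1 ≤ 0 + y + y' := by linarith
    have hb10 : ¬ 1 ≤ b + x + y' := by linarith
    simp only [hx, hy', h11, hb10, hy.not_gt, if_true, if_false]
    grind (splits := 40)
  simp only [hy.not_gt, hy'.not_gt, if_false]
  rcases lt_or_ge x b with hx | hx <;> rcases lt_or_ge x' b with hx' | hx'
  · simp only [hx, hx', if_true]
    grind (splits := 40)
  · simp only [hx, hx'.not_gt, if_true, if_false]
    grind (splits := 40)
  · simp only [hx.not_gt, hx', if_true, if_false]
    grind (splits := 40)
  · simp only [hx.not_gt, hx'.not_gt, if_false]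
    grind (splits := 40)

/-- The number of vanishing coordinates of `e`. -/
def zeroCount (e : Fin 3 → ℝ) : ℝ := ∑ i, if e i = 0 then 1 else 0

lemma zeroCount_comp (e : Fin 3 → ℝ) (σ : Equiv.Perm (Fin 3)) :
    zeroCount (e ∘ σ) = zeroCount e :=
  Equiv.sum_comp σ fun i => if e i = 0 then (1 : ℝ) else 0


/-- The position of the coordinates of `e` relative to `0` and `1 / 3`. -/
def tripleType (e : Fin 3 → ℝ) : Fin 5 :=
  if lightCount (1 / 3) e < 1 then 0
  else if lightCount (1 / 3) e < 2 then (if zeroCount e < 1 then 2 else 1)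
  else if zeroCount e < 2 then 3 else 4

/-- Upper bounds for `heavyPairs 0` in terms of `tripleType`. -/
def typeBound : Fin 5 → Fin 5 → ℝ :=
  ![![0, 3, 0, 3, 3], ![3, 4, 2, 2, 3], ![0, 2, 2, 3, 3], ![3, 2, 3, 3, 3], ![3, 3, 3, 3, 5]]

lemma tripleType_of_sorted {e : Fin 3 → ℝ} (h0 : 0 ≤ e 0) (h1 : e 0 ≤ e 1) (h2 : e 1 ≤ e 2)
    (h : e 0 + e 1 + e 2 ≤ 1) :
    tripleType e = if 1 / 3 ≤ e 0 then 0 else if 1 / 3 ≤ e 1 then (if e 0 = 0 then 1 else 2)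
      else if e 1 = 0 then 4 else 3 := by
  simp only [tripleType, lightCount, zeroCount, Fin.sum_univ_three]
  grind (splits := 20)

lemma tripleType_comp (e : Fin 3 → ℝ) (σ : Equiv.Perm (Fin 3)) :
    tripleType (e ∘ σ) = tripleType e := by
  simp only [tripleType, lightCount_comp, zeroCount_comp]

lemma heavyPairs_le_typeBound {e f : Fin 3 → ℝ} (he : IsWeightTriple e) (hf : IsWeightTriple f) :
    heavyPairs 0 e f ≤ typeBound (tripleType e) (tripleType f) := by
  obtain ⟨σ, h1, h2, h3, h4⟩ := he.exists_sorted
  obtain ⟨τ, k1, k2, k3, k4⟩ := hf.exists_sorted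
  rw [← heavyPairs_comp 0 e f σ τ, ← tripleType_comp e σ, ← tripleType_comp f τ,
    tripleType_of_sorted h1 h2 h3 h4, tripleType_of_sorted k1 k2 k3 k4]
  generalize hq : heavyPairs 0 (e ∘ σ) (f ∘ τ) = q
  generalize e ∘ σ = e at *
  generalize f ∘ τ = f at *
  simp only [heavyPairs, Fin.sum_univ_three] at hq
  generalize e 0 = x at *; generalize e 1 = y at *; generalize e 2 = z at *
  generalize f 0 = x' at *; generalize f 1 = y' at *; generalize f 2 = z' at *
  have h00 : ¬ 1 ≤ 0 + x + x' := by linarith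
  have h01 : ¬ 1 ≤ 0 + x + y' := by linarith
  have h10 : ¬ 1 ≤ 0 + y + x' := by linarith
  simp only [h00, h01, h10, if_false] at hq
  split_ifs <;> simp only [typeBound, Matrix.cons_val] <;> grind (splits := 40)

lemma typeForm_pos {y x p r s : ℝ} (hy : 0 ≤ y) (hx : 0 ≤ x) (hp : 0 ≤ p) (hr : 0 ≤ r) (hs : 0 ≤ s)
    (h1 : y + x + p + r + s = 1) (h2 : r + s ≤ y + 1 / 1000) (h3 : x + 2 * s ≤ 0.551) :
    0 < 3 * y ^ 2 + 6 * y * p - x ^ 2 + 2 * x * p + 2 * x * r + p ^ 2 - 2 * s ^ 2 := by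
  have hpq : p = 1 - y - x - r - s := by linarith
  have h4 : 2 * x * (1 - y - x - s) = 2 * x * p + 2 * x * r := by rw [hpq]; ring
  have a2 : 0.05 < 0.75 - 0.5 * x - 1.25 * x ^ 2 - 2 * x * s - 2 * s ^ 2 := by
    have : (x + 2 * s) ^ 2 ≤ 0.551 ^ 2 := by gcongr
    nlinarith [mul_nonneg hx hs, sq_nonneg s]
  rcases le_total 1 (x + 2 * y) with h | h
  · have a1 : 0 ≤ (y - (1 - x) / 2) * (3 * (y + (1 - x) / 2) - 2 * x) := by
      apply mul_nonneg <;> linarith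
    linarith [mul_nonneg hy hp, sq_nonneg p]
  · have hp1 : 1 - x - 2 * y - 1 / 1000 ≤ p := by linarith
    have h5 : 6 * y * (1 - x - 2 * y - 1 / 1000) ≤ 6 * y * p :=
      mul_le_mul_of_nonneg_left hp1 (by linarith)
    have h6 : (1 - x - 2 * y) ^ 2 - 1 / 100 ≤ p ^ 2 := by
      rcases le_total (1 - x - 2 * y) p with hu | hu
      · nlinarith [mul_nonneg (sub_nonneg.2 hu) (add_nonneg (sub_nonneg.2 h) hp)]
      · nlinarith [mul_nonneg (sub_nonneg.2 hu) (add_nonneg (sub_nonneg.2 h) hp)]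
    have a1 : 0 ≤ y * (1 - x - 2 * y) := mul_nonneg hy (by linarith)
    have a3 : 0 ≤ x * (1 - x - 2 * y) := mul_nonneg hx (by linarith)
    linarith [sq_nonneg (1 - x - 2 * y)]

lemma sum_lightCount {m : ℕ} (b : ℝ) (w : Fin m → Fin 3 → ℝ) :
    ∑ k, lightCount b (w k) = #{v : Fin m × Fin 3 | w v.1 v.2 < b} := by
  simp only [lightCount]
  rw [← Fintype.sum_prod_type' (f := fun k i => if w k i < b then (1 : ℝ) else 0)]
  simp

lemma sum_zeroCount {m : ℕ} (w : Fin m → Fin 3 → ℝ) :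
    ∑ k, zeroCount (w k) = #{v : Fin m × Fin 3 | w v.1 v.2 = 0} := by
  simp only [zeroCount]
  rw [← Fintype.sum_prod_type' (f := fun k i => if w k i = 0 then (1 : ℝ) else 0)]
  simp

lemma le_lightCount_of_tripleType (e : Fin 3 → ℝ) :
    (![0, 1, 1, 2, 2] : Fin 5 → ℝ) (tripleType e) ≤ lightCount (1 / 3) e := by
  have : 0 ≤ lightCount (1 / 3) e := Finset.sum_nonneg fun i _ => by split_ifs <;> norm_num
  unfold tripleType
  split_ifs <;> simp <;> linarith

lemma le_zeroCount_of_tripleType (e : Fin 3 → ℝ) :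
    (![0, 1, 0, 0, 2] : Fin 5 → ℝ) (tripleType e) ≤ zeroCount e := by
  have : 0 ≤ zeroCount e := Finset.sum_nonneg fun i _ => by split_ifs <;> norm_num
  unfold tripleType
  split_ifs <;> simp <;> linarith

lemma sum_comp_eq_sum_card {ι : Type*} [Fintype ι] {n : ℕ} (t : ι → Fin n) (g : Fin n → ℝ) :
    ∑ k, g (t k) = ∑ s, (#{k | t k = s} : ℝ) * g s := by
  rw [← Finset.sum_fiberwise (s := univ) (g := t)]
  refine Finset.sum_congr rfl fun s _ => ?_
  rw [Finset.sum_congr rfl (g := fun _ => g s) (by simp +contextual), Finset.sum_const,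
    nsmul_eq_mul]

lemma sum_heavyPairs_lt {m : ℕ} (hm : 0 < m) {w : Fin m → Fin 3 → ℝ}
    (hw : ∀ k, IsWeightTriple (w k))
    (hB : ∑ k, lightCount (1 / 3) (w k) ≤ (1 + 1 / 1000) * m)
    (hZ : ∑ k, zeroCount (w k) ≤ 0.551 * m) :
    ∑ k, ∑ l, heavyPairs 0 (w k) (w l) < 3 * (m : ℝ) ^ 2 := by
  have hm' : (0 : ℝ) < m := by exact_mod_cast hm
  set t : Fin m → Fin 5 := fun k => tripleType (w k)
  set c : Fin 5 → ℝ := fun s => #{k | t k = s} with hc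
  have hc0 : ∀ s, 0 ≤ c s := fun s => Nat.cast_nonneg _
  have h1 : ∑ k, ∑ l, heavyPairs 0 (w k) (w l) ≤ ∑ s, ∑ s', c s * (c s' * typeBound s s') := by
    calc ∑ k, ∑ l, heavyPairs 0 (w k) (w l) ≤ ∑ k, ∑ l, typeBound (t k) (t l) :=
          Finset.sum_le_sum fun k _ => Finset.sum_le_sum fun l _ =>
            heavyPairs_le_typeBound (hw k) (hw l)
      _ = ∑ s, ∑ s', c s * (c s' * typeBound s s') := by
          rw [sum_comp_eq_sum_card t fun s => ∑ l, typeBound s (t l)]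
          refine Finset.sum_congr rfl fun s _ => ?_
          rw [sum_comp_eq_sum_card t (typeBound s), Finset.mul_sum]
  have h2 : ∑ s, c s = m := by
    have := sum_comp_eq_sum_card t fun _ => 1
    simpa using this.symm
  have h3 : ∑ s, c s * (![0, 1, 1, 2, 2] : Fin 5 → ℝ) s ≤ (1 + 1 / 1000) * m := by
    rw [← sum_comp_eq_sum_card t]
    exact (Finset.sum_le_sum fun k _ => le_lightCount_of_tripleType (w k)).trans hB
  have h4 : ∑ s, c s * (![0, 1, 0, 0, 2] : Fin 5 → ℝ) s ≤ 0.551 * m := by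
    rw [← sum_comp_eq_sum_card t]
    exact (Finset.sum_le_sum fun k _ => le_zeroCount_of_tripleType (w k)).trans hZ
  refine h1.trans_lt ?_
  simp only [Fin.sum_univ_five, typeBound, Matrix.cons_val] at h2 h3 h4 ⊢
  clear_value c
  have key := typeForm_pos (y := c 0 / m) (x := c 1 / m) (p := c 2 / m) (r := c 3 / m)
    (s := c 4 / m) (div_nonneg (hc0 _) hm'.le) (div_nonneg (hc0 _) hm'.le)
    (div_nonneg (hc0 _) hm'.le) (div_nonneg (hc0 _) hm'.le) (div_nonneg (hc0 _) hm'.le)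
    (by rw [← h2] at hm' ⊢; field_simp)
    (by rw [← add_div, div_le_iff₀ hm', add_mul, div_mul_cancel₀ _ hm'.ne']; linarith)
    (by rw [← mul_div_assoc, ← add_div, div_le_iff₀ hm']; linarith)
  have h5 := mul_pos key (pow_pos hm' 2)
  have h6 : (3 * (c 0 / m) ^ 2 + 6 * (c 0 / m) * (c 2 / m) - (c 1 / m) ^ 2 +
      2 * (c 1 / m) * (c 2 / m) + 2 * (c 1 / m) * (c 3 / m) + (c 2 / m) ^ 2 -
      2 * (c 4 / m) ^ 2) * (m : ℝ) ^ 2 = 3 * (c 0) ^ 2 + 6 * c 0 * c 2 - c 1 ^ 2 +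
      2 * c 1 * c 2 + 2 * c 1 * c 3 + c 2 ^ 2 - 2 * c 4 ^ 2 := by
    field_simp
  rw [h6] at h5
  rw [← h2]
  linarith

/-- A weighting of the vertices of `m` triples in which each triple has weight at most `1` cannot
satisfy the degree conditions of the theorem if some vertex of large degree has weight `0`. -/
lemma false_of_weighting {γ η : ℝ} (hη : 0 ≤ η) (hηγ : η < γ) (hη' : η ≤ 1 / 1000)
    {m : ℕ} (hm : 0 < m) {w : Fin m → Fin 3 → ℝ} (hw : ∀ k, IsWeightTriple (w k))
    {S F : Finset (Fin m × Fin 3)} (hS : (#Sᶜ : ℝ) ≤ (1 + η) * m) (hF : (#Fᶜ : ℝ) ≤ 0.551 * m)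
    (hSdeg : ∀ v ∈ S, (5 + γ) * (m : ℝ) ^ 2 ≤ ∑ k, ∑ l, heavyPairs (w v.1 v.2) (w k) (w l))
    (hFdeg : ∀ v ∈ F, (4 + γ) * (m : ℝ) ^ 2 ≤ ∑ k, ∑ l, heavyPairs (w v.1 v.2) (w k) (w l))
    {v₀ : Fin m × Fin 3} (hv₀ : w v₀.1 v₀.2 = 0)
    (hdeg : (3 + γ) * (m : ℝ) ^ 2 ≤ ∑ k, ∑ l, heavyPairs (w v₀.1 v₀.2) (w k) (w l)) : False := by
  have hm' : (0 : ℝ) < m := by exact_mod_cast hm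
  have hmm : (0 : ℝ) < (m : ℝ) ^ 2 := by positivity
  rw [hv₀] at hdeg
  have hSne : S.Nonempty := by
    rw [Finset.nonempty_iff_ne_empty]
    rintro rfl
    simp at hS
    nlinarith
  obtain ⟨v, hv, hmin⟩ := S.exists_min_image (fun v => w v.1 v.2) hSne
  have hvdeg := hSdeg v hv
  set b := w v.1 v.2 with hb
  have hb0 : 0 ≤ b := (hw _).1 _
  have hlight : ∀ c ≤ b, ∑ k, lightCount c (w k) ≤ (1 + η) * m := by
    intro c hc
    rw [sum_lightCount]
    refine le_trans ?_ hS
    gcongr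
    intro u hu
    simp only [mem_filter, mem_univ, true_and, mem_compl] at hu ⊢
    exact fun h => absurd (hmin u h) (by linarith)
  have hsum : ∀ (g : Fin m → ℝ) (a : ℝ), ∑ k, ∑ l, (a + g k + g l) =
      a * (m : ℝ) ^ 2 + 2 * m * ∑ k, g k := by
    intro g a
    simp only [Finset.sum_add_distrib, Finset.sum_const, Finset.card_univ, Fintype.card_fin,
      nsmul_eq_mul, ← Finset.mul_sum]
    ring
  rcases hb0.eq_or_lt with hb1 | hb1
  · have : ∑ k, ∑ l, heavyPairs b (w k) (w l) ≤ ∑ _k : Fin m, ∑ _l : Fin m, (5 : ℝ) := by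
      rw [← hb1]
      exact Finset.sum_le_sum fun k _ => Finset.sum_le_sum fun l _ =>
        heavyPairs_zero_le_five (hw k) (hw l)
    simp only [Finset.sum_const, Finset.card_univ, Fintype.card_fin, nsmul_eq_mul] at this
    nlinarith
  by_cases hF0 : ∃ u ∈ F, w u.1 u.2 = 0
  · obtain ⟨u, hu, hu0⟩ := hF0
    have h1 := hFdeg u hu
    rw [hu0] at h1
    have h2 : 2 * ∑ k, ∑ l, heavyPairs 0 (w k) (w l) ≤
        ∑ k, ∑ l, (6 + lightCount b (w k) + lightCount b (w l)) := by
      simp only [Finset.mul_sum]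
      exact Finset.sum_le_sum fun k _ => Finset.sum_le_sum fun l _ =>
        two_mul_heavyPairs_le hb1 (hw k) (hw l)
    rw [hsum] at h2
    have h3 := hlight b le_rfl
    nlinarith
  rcases lt_or_ge b (1 / 3) with hb2 | hb2
  · have h2 : ∑ k, ∑ l, heavyPairs 0 (w k) (w l) + ∑ k, ∑ l, heavyPairs b (w k) (w l) ≤
        ∑ k, ∑ l, (8 + halfDefect (w l) * (lightCount b (w k) - 1) +
          halfDefect (w k) * (lightCount b (w l) - 1)) := by
      simp only [← Finset.sum_add_distrib]
      exact Finset.sum_le_sum fun k _ => Finset.sum_le_sum fun l _ =>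
        heavyPairs_add_heavyPairs_le hb1 hb2 (hw k) (hw l)
    have h3 : ∑ k, ∑ l, (8 + halfDefect (w l) * (lightCount b (w k) - 1) +
          halfDefect (w k) * (lightCount b (w l) - 1)) = 8 * (m : ℝ) ^ 2 +
        2 * ((∑ k, halfDefect (w k)) * (∑ k, lightCount b (w k) - m)) := by
      have : ∀ k, ∑ l, halfDefect (w l) * (lightCount b (w k) - 1) =
          (∑ l, halfDefect (w l)) * (lightCount b (w k) - 1) := fun k => by rw [Finset.sum_mul]
      simp only [Finset.sum_add_distrib, Finset.sum_const, Finset.card_univ, Fintype.card_fin,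
        nsmul_eq_mul, this, ← Finset.mul_sum, ← Finset.sum_mul, Finset.sum_sub_distrib]
      ring
    have h4 := hlight b le_rfl
    have h5 : 0 ≤ ∑ k, halfDefect (w k) :=
      Finset.sum_nonneg fun k _ => by unfold halfDefect; split_ifs <;> norm_num
    have h6 : ∑ k, halfDefect (w k) ≤ m := by
      have : ∑ k, halfDefect (w k) ≤ ∑ _k : Fin m, (1 : ℝ) :=
        Finset.sum_le_sum fun k _ => by unfold halfDefect; split_ifs <;> norm_num
      simpa using this
    have h7 : (∑ k, halfDefect (w k)) * (∑ k, lightCount b (w k) - m) ≤ m * (η * m) := by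
      calc _ ≤ (∑ k, halfDefect (w k)) * (η * m) :=
            mul_le_mul_of_nonneg_left (by linarith) h5
        _ ≤ _ := mul_le_mul_of_nonneg_right h6 (by positivity)
    nlinarith
  · have h1 : ∑ k, zeroCount (w k) ≤ 0.551 * m := by
      rw [sum_zeroCount]
      refine le_trans ?_ hF
      gcongr
      intro u hu
      simp only [mem_filter, mem_univ, true_and, mem_compl] at hu ⊢
      exact fun h => hF0 ⟨u, h, hu⟩
    have h2 := sum_heavyPairs_lt hm hw
      ((hlight _ hb2).trans (mul_le_mul_of_nonneg_right (by linarith) hm'.le)) h1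
    nlinarith

/-- A fractional packing of total weight more than `r` can be made integral after scaling. -/
lemma exists_nat_packing {ι V : Type*} [Fintype ι] [Fintype V] (E : ι → V → ℕ) (r : ℕ)
    {x : ι → ℝ} (hx : x ∈ stdSimplex ℝ ι) (hlt : ∀ v, r * ∑ e, x e * E e v < 1) :
    ∃ (c : ι → ℕ) (C : ℕ), (∀ v, ∑ e, c e * E e v ≤ C) ∧ r * C < ∑ e, c e := by
  have hQ : ∀ᶠ Q : ℕ in Filter.atTop, (Fintype.card ι : ℝ) < Q ∧
      ∀ v, (Fintype.card ι : ℝ) < Q * (1 - r * ∑ e, x e * E e v) := by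
    refine (tendsto_natCast_atTop_atTop.eventually_gt_atTop _).and
      (Filter.eventually_all.2 fun v => ?_)
    exact (tendsto_natCast_atTop_atTop.atTop_mul_const
      (sub_pos.2 (hlt v))).eventually_gt_atTop _
  obtain ⟨Q, hQ0, hQ⟩ := hQ.exists
  let c : ι → ℕ := fun e => ⌊(Q : ℝ) * x e⌋₊
  refine ⟨c, univ.sup fun v => ∑ e, c e * E e v,
    fun v => le_sup (f := fun v => ∑ e, c e * E e v) (mem_univ v), ?_⟩
  have hc : (Q : ℝ) - Fintype.card ι ≤ ∑ e, (c e : ℝ) := by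
    have h : ∑ e, ((Q : ℝ) * x e - 1) ≤ ∑ e, (c e : ℝ) :=
      sum_le_sum fun e _ => (Nat.sub_one_lt_floor _).le
    rw [sum_sub_distrib, ← mul_sum, hx.2] at h
    simpa using h
  rcases isEmpty_or_nonempty V with hV | hV
  · rw [univ_eq_empty, sup_empty, Nat.bot_eq_zero, mul_zero]
    have : (0 : ℝ) < ∑ e, (c e : ℝ) := by linarith
    exact_mod_cast this
  · obtain ⟨v, -, hv⟩ := exists_mem_eq_sup univ univ_nonempty fun v => ∑ e, c e * E e v
    rw [hv]
    have h1 : ∑ e, (c e : ℝ) * E e v ≤ Q * ∑ e, x e * E e v := by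
      rw [mul_sum]
      refine sum_le_sum fun e _ => ?_
      rw [← mul_assoc]
      exact mul_le_mul_of_nonneg_right
        (Nat.floor_le (mul_nonneg (Nat.cast_nonneg _) (hx.1 e))) (Nat.cast_nonneg _)
    have h2 : (r : ℝ) * ∑ e, (c e : ℝ) * E e v ≤ r * (Q * ∑ e, x e * E e v) :=
      mul_le_mul_of_nonneg_left h1 (Nat.cast_nonneg _)
    have h3 := hQ v
    have : (r : ℝ) * ∑ e, (c e : ℝ) * E e v < ∑ e, (c e : ℝ) := by nlinarith
    exact_mod_cast this

/-- Linear programming duality for fractional matchings and fractional covers. -/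
lemma exists_packing_or_cover {ι V : Type*} [Fintype ι] [Fintype V] (E : ι → V → ℕ) (r : ℕ) :
    (∃ (c : ι → ℕ) (C : ℕ), (∀ v, ∑ e, c e * E e v ≤ C) ∧ r * C < ∑ e, c e) ∨
    ∃ w : V → ℝ, (∀ v, 0 ≤ w v) ∧ (∀ e, 1 ≤ ∑ v, (E e v : ℝ) * w v) ∧ ∑ v, w v ≤ r := by
  let B : Set (V → ℝ) := {y | ∀ v, r * y v < 1}
  let K : Set (V → ℝ) := (fun x : ι → ℝ => fun v => ∑ e, x e * E e v) '' stdSimplex ℝ ι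
  by_cases hBK : Disjoint B K
  · right
    have hB : Convex ℝ B := by
      intro x hx y hy a b ha hb hab v
      have h1 := hx v
      have h2 := hy v
      simp only [Pi.add_apply, Pi.smul_apply, smul_eq_mul]
      rcases ha.eq_or_lt with rfl | ha
      · obtain rfl : b = 1 := by linarith
        simpa using h2
      · nlinarith
    have hBo : IsOpen B := by
      have : B = ⋂ v, {y : V → ℝ | (r : ℝ) * y v < 1} := by ext; simp [B]
      rw [this]
      exact isOpen_iInter_of_finite fun v => isOpen_lt (by fun_prop) continuous_const
    have hK : Convex ℝ K := by
      refine (convex_stdSimplex ℝ ι).is_linear_image ⟨fun x y => ?_, fun a x => ?_⟩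
      · ext v; simp [add_mul, sum_add_distrib]
      · ext v; simp [mul_sum, mul_assoc]
    obtain ⟨f, u, hfB, hfK⟩ := geometric_hahn_banach_open hB hBo hK hBK
    have hu : 0 < u := by simpa using hfB 0 (fun v => by simp)
    let w : V → ℝ := fun v => f (Pi.single v 1)
    have hf : ∀ y, f y = ∑ v, y v * w v := by
      intro y
      conv_lhs => rw [pi_eq_sum_univ' y]
      rw [map_sum]
      refine sum_congr rfl fun v _ => ?_
      rw [map_smul, smul_eq_mul]
    have hw : ∀ v, 0 ≤ w v := by
      intro v
      by_contra! h
      have := hfB (Pi.single v (u / w v)) (fun j => by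
        by_cases hj : j = v
        · subst hj
          have : (r : ℝ) * (u / w j) ≤ 0 :=
            mul_nonpos_of_nonneg_of_nonpos (Nat.cast_nonneg _)
              (div_nonpos_of_nonneg_of_nonpos hu.le h.le)
          simp; linarith
        · simp [hj])
      rw [hf, sum_eq_single v (by intro b _ hb; simp [hb]) (by simp)] at this
      simp [div_mul_cancel₀ _ h.ne] at this
    refine ⟨fun v => w v / u, fun v => div_nonneg (hw v) hu.le, fun e => ?_, ?_⟩
    · have := hfK _ ⟨Pi.single e 1, single_mem_stdSimplex ℝ e, rfl⟩
      rw [hf] at this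
      simp only [mul_div_assoc', ← sum_div]
      rw [one_le_div hu]
      refine this.trans_eq (sum_congr rfl fun v _ => ?_)
      dsimp only
      rw [sum_eq_single e (by intro b _ hb; simp [hb]) (by simp)]
      simp
    · rw [← sum_div, div_le_iff₀ hu]
      by_contra! h
      have hpos : 0 < ∑ v, w v := lt_of_le_of_lt (by positivity) h
      have := hfB (fun _ => u / ∑ v, w v) (fun v => by
        rw [mul_div_assoc', div_lt_one hpos]; exact h)
      rw [hf, ← mul_sum, div_mul_cancel₀ _ hpos.ne'] at this
      exact lt_irrefl _ this
  · left
    obtain ⟨y, hyB, x, hx, rfl⟩ := Set.not_disjoint_iff.1 hBK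
    exact exists_nat_packing E r hx hyB

lemma sum_le_card_filter_mul_add {α : Type*} (s : Finset α) (a : α → ℝ) {M d : ℝ}
    (hM : ∀ i ∈ s, a i ≤ M) (hd : 0 ≤ d) :
    ∑ i ∈ s, a i ≤ #{i ∈ s | d ≤ a i} * M + #s * d := by
  rw [← sum_filter_add_sum_filter_not s (fun i => d ≤ a i)]
  refine add_le_add ?_ ?_
  · rw [← nsmul_eq_mul]
    exact sum_le_card_nsmul _ _ _ fun i hi => hM i (mem_filter.1 hi).1
  · refine (sum_le_card_nsmul _ _ d fun i hi => (not_le.1 (mem_filter.1 hi).2).le).trans ?_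
    rw [nsmul_eq_mul]
    exact mul_le_mul_of_nonneg_right (by exact_mod_cast card_filter_le _ _) hd

/-- A dense set of `m`-tuples contains a complete `m`-partite configuration
with parts of size `Q`. -/
lemma exists_complete_partite (Q m : ℕ) : ∀ δ : ℝ, 0 < δ → ∃ r₀ : ℕ, ∀ (P : Type) [Fintype P],
    r₀ ≤ Fintype.card P → ∀ 𝓕 : Finset (Fin m → P), δ * (Fintype.card P : ℝ) ^ m ≤ #𝓕 →
      ∃ U : Fin m → Finset P, (∀ i, #(U i) = Q) ∧ ∀ f, (∀ i, f i ∈ U i) → f ∈ 𝓕 := by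
  induction m with
  | zero =>
    intro δ hδ
    refine ⟨0, fun P _ _ 𝓕 h => ⟨fun i => i.elim0, fun i => i.elim0, fun f _ => ?_⟩⟩
    have : 0 < #𝓕 := by
      rw [pow_zero, mul_one] at h
      exact_mod_cast hδ.trans_le h
    obtain ⟨g, hg⟩ := card_pos.1 this
    rwa [Subsingleton.elim f g]
  | succ m ih =>
    intro δ hδ
    obtain ⟨ℓ, hℓ⟩ := exists_nat_gt (4 * (Q + 1) / δ)
    rw [div_lt_iff₀ hδ] at hℓ
    have hℓ0 : (0 : ℝ) < ℓ := by
      have : (0 : ℝ) < ℓ * δ := lt_of_le_of_lt (by positivity) hℓ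
      exact pos_of_mul_pos_left this hδ.le
    obtain ⟨r₁, hr₁⟩ := ih (δ / 4 / 2 ^ ℓ) (by positivity)
    obtain ⟨r₂, hr₂⟩ := exists_nat_gt (2 * ℓ / δ)
    rw [div_lt_iff₀ hδ] at hr₂
    refine ⟨max r₁ (r₂ + 1), fun P _ hP 𝓕 h𝓕 => ?_⟩
    set r := Fintype.card P with hr
    have hPr₁ : r₁ ≤ r := (le_max_left _ _).trans hP
    have hPr₂ : (r₂ : ℝ) + 1 ≤ r := by exact_mod_cast (le_max_right _ _).trans hP
    have hr0 : (0 : ℝ) < r := by linarith [Nat.cast_nonneg (α := ℝ) r₂]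
    have hcardF : (Fintype.card (Fin m → P) : ℝ) = (r : ℝ) ^ m := by simp [hr]
    let A : P → Finset (Fin m → P) := fun p => {f | Fin.cons p f ∈ 𝓕}
    have hsum : (#𝓕 : ℝ) = ∑ p, (#(A p) : ℝ) := by
      rw [← Nat.cast_sum, ← card_sigma]
      congr 1
      refine card_bij' (fun f _ => ⟨f 0, Fin.tail f⟩) (fun x _ => Fin.cons x.1 x.2) ?_ ?_ ?_ ?_
      · intro f hf; simpa [A] using hf
      · intro x hx; simpa [A] using hx
      · intro f _; simp
      · intro x _; simp
    let X : Finset P := {p | δ / 2 * (r : ℝ) ^ m ≤ #(A p)}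
    have hX : ℓ ≤ #X := by
      have h := sum_le_card_filter_mul_add univ (fun p => (#(A p) : ℝ)) (M := (r : ℝ) ^ m)
        (d := δ / 2 * (r : ℝ) ^ m)
        (fun p _ => by rw [← hcardF]; exact_mod_cast card_le_univ _) (by positivity)
      rw [← hsum, card_univ, ← hr] at h
      have h1 : δ / 2 * r * (r : ℝ) ^ m ≤ #X * (r : ℝ) ^ m := by
        rw [pow_succ] at h𝓕
        have := h𝓕.trans h
        simp only [X]
        linarith
      have h2 := le_of_mul_le_mul_right h1 (by positivity)
      have h3 : (ℓ : ℝ) ≤ #X := by nlinarith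
      exact_mod_cast h3
    obtain ⟨L, hLX, hL⟩ := exists_subset_card_eq hX
    let N : (Fin m → P) → Finset P := fun f => {p ∈ L | Fin.cons p f ∈ 𝓕}
    have hN : (∑ f, (#(N f) : ℝ)) = ∑ p ∈ L, (#(A p) : ℝ) := by
      simp only [N, A, card_filter, Nat.cast_sum]
      rw [sum_comm]
    let Y : Finset (Fin m → P) := {f | (Q : ℝ) ≤ #(N f)}
    have hY : δ / 4 * (r : ℝ) ^ m ≤ #Y := by
      have h := sum_le_card_filter_mul_add univ (fun f => (#(N f) : ℝ)) (M := (ℓ : ℝ))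
        (d := (Q : ℝ))
        (fun p _ => by rw [← hL]; exact_mod_cast card_filter_le _ _) (by positivity)
      have h1 : (#L : ℝ) * (δ / 2 * (r : ℝ) ^ m) ≤ ∑ p ∈ L, (#(A p) : ℝ) := by
        rw [← nsmul_eq_mul]
        exact card_nsmul_le_sum _ _ _ fun p hp => (mem_filter.1 (hLX hp)).2
      rw [hN, card_univ, hcardF] at h
      rw [hL] at h1
      have h2 : ℓ * (δ / 4 * (r : ℝ) ^ m) ≤ ℓ * #Y := by
        have h4 : (Q : ℝ) * (r : ℝ) ^ m ≤ ℓ * δ / 4 * (r : ℝ) ^ m :=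
          mul_le_mul_of_nonneg_right (by linarith) (by positivity)
        have := h1.trans h
        simp only [Y]
        linarith
      exact le_of_mul_le_mul_left h2 hℓ0
    have hT : ∀ f ∈ Y, ∃ T ⊆ N f, #T = Q := fun f hf =>
      exists_subset_card_eq (by exact_mod_cast (mem_filter.1 hf).2)
    choose! T hTN hTQ using hT
    obtain ⟨T₀, -, hT₀⟩ := exists_le_card_fiber_of_nsmul_le_card_of_maps_to
      (s := Y) (t := L.powerset) (f := T) (b := δ / 4 / 2 ^ ℓ * (r : ℝ) ^ m)
      (fun f hf => mem_powerset.2 ((hTN f hf).trans (filter_subset _ _)))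
      ⟨∅, empty_mem_powerset _⟩ (by
        rw [card_powerset, hL, nsmul_eq_mul]
        push_cast
        rw [← mul_assoc, mul_div_cancel₀ _ (by positivity)]
        exact hY)
    obtain ⟨U, hU, hUF⟩ := hr₁ P hPr₁ _ hT₀
    have hYne : #{f ∈ Y | T f = T₀} ≠ 0 := by
      have : (0 : ℝ) < #{f ∈ Y | T f = T₀} := lt_of_lt_of_le (by positivity) hT₀
      exact_mod_cast this.ne'
    obtain ⟨f₀, hf₀⟩ := card_ne_zero.1 hYne
    rw [mem_filter] at hf₀
    refine ⟨Fin.cons T₀ U, fun i => ?_, fun f hf => ?_⟩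
    · refine Fin.cases ?_ (fun i => ?_) i
      · simpa [← hf₀.2] using hTQ _ hf₀.1
      · simpa using hU i
    · have h0 : f 0 ∈ T₀ := by simpa using hf 0
      have h1 := hUF (Fin.tail f) fun i => by simpa [Fin.tail] using hf i.succ
      rw [mem_filter] at h1
      have h2 := hTN _ h1.1 (h1.2.symm ▸ h0)
      simpa [N] using (mem_filter.1 h2).2

lemma sum_sum_update {ι P : Type*} [Fintype ι] [DecidableEq ι] [Fintype P] (F : (ι → P) → ℝ)
    (i : ι) :
    ∑ f, ∑ p, F (Function.update f i p) = Fintype.card P * ∑ f, F f := by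
  have h : ∑ x : (ι → P) × P, F (Function.update x.1 i x.2) = ∑ x : (ι → P) × P, F x.1 := by
    refine sum_bij' (fun x _ => (Function.update x.1 i x.2, x.1 i))
      (fun x _ => (Function.update x.1 i x.2, x.1 i)) ?_ ?_ ?_ ?_ ?_ <;> simp
  rw [Fintype.sum_prod_type, Fintype.sum_prod_type] at h
  rw [h, mul_sum]
  simp

lemma sum_mul_eq_zero_of_update {ι P : Type*} [Fintype ι] [DecidableEq ι] [Fintype P]
    (G : P → P → P → ℝ) (hG : ∀ v, ∑ p, ∑ q, G v p q = 0) {k i j k' i' j' : ι}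
    (hij : i ≠ j) (hik : i ≠ k) (hjk : j ≠ k) (hik' : i ≠ k') (hjk' : j ≠ k')
    (hii : i ≠ i') (hij' : i ≠ j') (hji : j ≠ i') (hjj : j ≠ j') :
    ∑ f : ι → P, G (f k) (f i) (f j) * G (f k') (f i') (f j') = 0 := by
  rcases isEmpty_or_nonempty P with hP | hP
  · exact sum_eq_zero fun f _ => (hP.false (f i)).elim
  have hr : (Fintype.card P : ℝ) ≠ 0 := by exact_mod_cast Fintype.card_ne_zero
  refine (mul_eq_zero.1 ?_).resolve_left hr
  refine (mul_eq_zero.1 ?_).resolve_left hr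
  let F : (ι → P) → ℝ := fun f => G (f k) (f i) (f j) * G (f k') (f i') (f j')
  change _ * (_ * ∑ f, F f) = 0
  rw [← sum_sum_update F j, ← sum_sum_update (fun f => ∑ q, F (Function.update f j q)) i]
  refine sum_eq_zero fun f _ => ?_
  simp only [F, Function.update_self, Function.update_of_ne hij, Function.update_of_ne hik.symm,
    Function.update_of_ne hjk.symm, Function.update_of_ne hik'.symm,
    Function.update_of_ne hjk'.symm, Function.update_of_ne hii.symm,
    Function.update_of_ne hij'.symm, Function.update_of_ne hji.symm,
    Function.update_of_ne hjj.symm, ← sum_mul, hG, zero_mul]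

lemma sum_sq_le {ι P : Type*} [Fintype ι] [DecidableEq ι] [Fintype P] (G : P → P → P → ℝ)
    (hG : ∀ v, ∑ p, ∑ q, G v p q = 0) {K : ℝ} (hK : ∀ v p q, |G v p q| ≤ K) :
    ∑ f : ι → P, ∑ k, (∑ i, ∑ j, G (f k) (f i) (f j)) ^ 2 ≤
      7 * K ^ 2 * Fintype.card ι ^ 4 * Fintype.card P ^ Fintype.card ι := by
  set m := Fintype.card ι with hm
  set R : ℝ := K ^ 2 * (Fintype.card P : ℝ) ^ m with hR
  have hR0 : 0 ≤ R := by positivity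
  have hone : ∀ k i j i' j' : ι, ∑ f : ι → P, G (f k) (f i) (f j) * G (f k) (f i') (f j') ≤
      R * ((if i = j then 1 else 0) + (if i = k then 1 else 0) + (if j = k then 1 else 0) +
        (if i = i' then 1 else 0) + (if i = j' then 1 else 0) + (if j = i' then 1 else 0) +
        (if j = j' then 1 else 0)) := by
    intro k i j i' j'
    by_cases hgood : i ≠ j ∧ i ≠ k ∧ j ≠ k ∧ i ≠ i' ∧ i ≠ j' ∧ j ≠ i' ∧ j ≠ j'
    · obtain ⟨h1, h2, h3, h4, h5, h6, h7⟩ := hgood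
      rw [sum_mul_eq_zero_of_update G hG h1 h2 h3 h2 h3 h4 h5 h6 h7]
      positivity
    · have h1 : ∑ f : ι → P, G (f k) (f i) (f j) * G (f k) (f i') (f j') ≤ R := by
        have : ∀ f ∈ (univ : Finset (ι → P)),
            G (f k) (f i) (f j) * G (f k) (f i') (f j') ≤ K ^ 2 := fun f _ => by
          rw [sq]
          refine (le_abs_self _).trans ?_
          rw [abs_mul]
          exact mul_le_mul (hK _ _ _) (hK _ _ _) (abs_nonneg _)
            ((abs_nonneg _).trans (hK (f k) (f i) (f j)))
        refine (sum_le_card_nsmul _ _ _ this).trans_eq ?_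
        rw [nsmul_eq_mul, hR, card_univ]
        simp [hm, mul_comm]
      refine h1.trans (le_mul_of_one_le_right hR0 ?_)
      have hn : ∀ (p : Prop) [Decidable p], (0 : ℝ) ≤ if p then 1 else 0 := fun p _ => by
        split_ifs <;> norm_num
      have n1 := hn (i = j); have n2 := hn (i = k); have n3 := hn (j = k); have n4 := hn (i = i')
      have n5 := hn (i = j'); have n6 := hn (j = i'); have n7 := hn (j = j')
      by_contra! h
      apply hgood
      refine ⟨?_, ?_, ?_, ?_, ?_, ?_, ?_⟩ <;> intro he <;> rw [if_pos he] at h <;> linarith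
  calc ∑ f : ι → P, ∑ k, (∑ i, ∑ j, G (f k) (f i) (f j)) ^ 2
      = ∑ k, ∑ i, ∑ j, ∑ i', ∑ j', ∑ f : ι → P,
          G (f k) (f i) (f j) * G (f k) (f i') (f j') := by
        rw [sum_comm]
        refine sum_congr rfl fun k _ => ?_
        simp_rw [sq, sum_mul, mul_sum]
        rw [sum_comm]
        refine sum_congr rfl fun i _ => ?_
        rw [sum_comm]
        refine sum_congr rfl fun j _ => ?_
        rw [sum_comm]
        refine sum_congr rfl fun i' _ => ?_
        rw [sum_comm]
    _ ≤ ∑ k : ι, ∑ i : ι, ∑ j : ι, ∑ i' : ι, ∑ j' : ι, R *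
        ((if i = j then 1 else 0) + (if i = k then 1 else 0) + (if j = k then 1 else 0) +
        (if i = i' then 1 else 0) + (if i = j' then 1 else 0) + (if j = i' then 1 else 0) +
        (if j = j' then 1 else 0)) :=
        sum_le_sum fun k _ => sum_le_sum fun i _ => sum_le_sum fun j _ => sum_le_sum fun i' _ =>
          sum_le_sum fun j' _ => hone k i j i' j'
    _ = _ := by
        simp only [← mul_sum, sum_add_distrib, sum_ite_eq, sum_const, card_univ, nsmul_eq_mul,
          mem_univ, if_true, ← hm, sum_ite_eq', mul_ite, mul_one, mul_zero]
        rw [hR]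
        ring

/-- For most `f`, most values of the statistic `∑ i, ∑ j, G (f k) (f i) (f j)` are small. -/
lemma card_filter_deviation_le {P : Type*} [Fintype P] {m : ℕ} (hm : 0 < m) (G : P → P → P → ℝ)
    (hG : ∀ v, ∑ p, ∑ q, G v p q = 0) {K : ℝ} (hK : ∀ v p q, |G v p q| ≤ K) {η : ℝ} (hη : 0 < η) :
    (#{f : Fin m → P | η * m < #{k | η * m ^ 2 < |∑ i, ∑ j, G (f k) (f i) (f j)|}} : ℝ) ≤
      7 * K ^ 2 / (η ^ 3 * m) * Fintype.card P ^ m := by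
  have hm' : (0 : ℝ) < m := by exact_mod_cast hm
  have h := sum_sq_le (ι := Fin m) G hG hK
  rw [Fintype.card_fin] at h
  set X : Finset (Fin m → P) :=
    {f : Fin m → P | η * m < #{k | η * m ^ 2 < |∑ i, ∑ j, G (f k) (f i) (f j)|}} with hX
  have h1 : ∀ f ∈ X, η * m * (η * m ^ 2) ^ 2 ≤
      ∑ k, (∑ i, ∑ j, G (f k) (f i) (f j)) ^ 2 := by
    intro f hf
    rw [hX, mem_filter] at hf
    have h2 : (#{k | η * (m : ℝ) ^ 2 < |∑ i, ∑ j, G (f k) (f i) (f j)|} : ℝ) * (η * m ^ 2) ^ 2 ≤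
        ∑ k ∈ {k | η * (m : ℝ) ^ 2 < |∑ i, ∑ j, G (f k) (f i) (f j)|},
          (∑ i, ∑ j, G (f k) (f i) (f j)) ^ 2 := by
      rw [← nsmul_eq_mul]
      refine card_nsmul_le_sum _ _ _ fun k hk => ?_
      rw [← sq_abs (∑ i, ∑ j, G (f k) (f i) (f j))]
      exact pow_le_pow_left₀ (by positivity) (mem_filter.1 hk).2.le 2
    refine (mul_le_mul_of_nonneg_right hf.2.le (by positivity)).trans (h2.trans ?_)
    exact sum_le_sum_of_subset_of_nonneg (filter_subset _ _) fun _ _ _ => sq_nonneg _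
  have h3 : (#X : ℝ) * (η * m * (η * m ^ 2) ^ 2) ≤
      7 * K ^ 2 * m ^ 4 * (Fintype.card P : ℝ) ^ m := by
    rw [← nsmul_eq_mul]
    refine (card_nsmul_le_sum _ _ _ h1).trans (le_trans ?_ h)
    exact sum_le_sum_of_subset_of_nonneg (subset_univ _) fun _ _ _ =>
      sum_nonneg fun _ _ => sq_nonneg _
  rw [div_mul_eq_mul_div, le_div_iff₀ (by positivity)]
  have h4 : (0 : ℝ) < (m : ℝ) ^ 4 := by positivity
  refine le_of_mul_le_mul_right ?_ h4
  calc _ = (#X : ℝ) * (η * m * (η * m ^ 2) ^ 2) := by ring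
    _ ≤ _ := h3
    _ = _ := by ring

lemma card_not_injective_le {P : Type*} [Fintype P] [Nonempty P] (m : ℕ) :
    (#{f : Fin m → P | ¬ Function.Injective f} : ℝ) ≤
      (m : ℝ) ^ 2 / Fintype.card P * Fintype.card P ^ m := by
  have hr : (0 : ℝ) < Fintype.card P := by exact_mod_cast Fintype.card_pos
  have h1 : ∀ x ∈ (univ : Finset (Fin m)).offDiag,
      (#{f : Fin m → P | f x.1 = f x.2} : ℝ) ≤ (Fintype.card P : ℝ) ^ m / Fintype.card P := by
    intro x hx
    have hx := (mem_offDiag.1 hx).2.2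
    have h2 := sum_sum_update (fun f : Fin m → P => if f x.1 = f x.2 then (1 : ℝ) else 0) x.1
    have h3 : ∀ f : Fin m → P, ∑ p, (if Function.update f x.1 p x.1 = Function.update f x.1 p x.2
        then (1 : ℝ) else 0) = 1 := fun f => by
      simp [Function.update_of_ne hx.symm]
    simp_rw [h3] at h2
    rw [sum_boole] at h2
    rw [le_div_iff₀ hr, mul_comm, ← h2]
    simp
  have h4 : ({f : Fin m → P | ¬ Function.Injective f} : Finset (Fin m → P)) ⊆
      (univ : Finset (Fin m)).offDiag.biUnion fun x => {f : Fin m → P | f x.1 = f x.2} := by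
    intro f hf
    have hf := (mem_filter.1 hf).2
    simp only [Function.Injective, not_forall] at hf
    obtain ⟨a, b, hab, hne⟩ := hf
    exact mem_biUnion.2 ⟨(a, b), by simp [hne], by simp [hab]⟩
  have h5 : (#{f : Fin m → P | ¬ Function.Injective f} : ℝ) ≤
      ∑ x ∈ (univ : Finset (Fin m)).offDiag, (#{f : Fin m → P | f x.1 = f x.2} : ℝ) := by
    exact_mod_cast (card_le_card h4).trans card_biUnion_le
  refine h5.trans ((sum_le_card_nsmul _ _ _ h1).trans ?_)
  rw [nsmul_eq_mul, div_mul_eq_mul_div, mul_div_assoc]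
  refine mul_le_mul_of_nonneg_right ?_ (by positivity)
  have : #(univ : Finset (Fin m)).offDiag ≤ m ^ 2 := by
    rw [offDiag_card, card_univ, Fintype.card_fin, sq]; omega
  exact_mod_cast this

/-- Simultaneous concentration of finitely many statistics along a random injection. -/
lemma exists_forall_concentrated (σ : Type) [Fintype σ] (K : ℝ) {η : ℝ} (hη : 0 < η) :
    ∃ m₀ : ℕ, ∀ m ≥ m₀, ∃ r₀ : ℕ, ∀ (P : Type) [Fintype P], r₀ ≤ Fintype.card P →
      ∀ G : σ → P → P → P → ℝ, (∀ s v, ∑ p, ∑ q, G s v p q = 0) →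
        (∀ s v p q, |G s v p q| ≤ K) →
        1 / 4 * (Fintype.card P : ℝ) ^ m ≤ #{f : Fin m → P | Function.Injective f ∧
          ∀ s, (#{k | η * m ^ 2 < |∑ i, ∑ j, G s (f k) (f i) (f j)|} : ℝ) ≤ η * m} := by
  obtain ⟨m₀, hm₀⟩ := exists_nat_gt (2 * (Fintype.card σ * (7 * K ^ 2 / η ^ 3)))
  refine ⟨m₀ + 1, fun m hm => ⟨4 * m ^ 2 + 1, fun P _ hP G hG hK => ?_⟩⟩
  have : Nonempty P := Fintype.card_pos_iff.1 (by omega)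
  have hm1 : 0 < m := by omega
  have hm' : (0 : ℝ) < m := by exact_mod_cast hm1
  set r := Fintype.card P with hr
  have hr0 : (0 : ℝ) < r := by exact_mod_cast (by omega : 0 < r)
  set Z : Finset (Fin m → P) := {f : Fin m → P | Function.Injective f ∧
          ∀ s, (#{k | η * m ^ 2 < |∑ i, ∑ j, G s (f k) (f i) (f j)|} : ℝ) ≤ η * m} with hZ
  have hcover : (univ : Finset (Fin m → P)) ⊆ Z ∪
      (({f | ¬ Function.Injective f} : Finset (Fin m → P)) ∪
      univ.biUnion fun s => ({f | η * m <
        #{k | η * m ^ 2 < |∑ i, ∑ j, G s (f k) (f i) (f j)|}} : Finset (Fin m → P))) := by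
    intro f _
    simp only [hZ, mem_union, mem_filter, mem_univ, true_and, mem_biUnion]
    by_contra! h
    exact h.1 h.2.1 |>.elim fun s => (h.2.2 s).not_gt
  have h1 := (card_le_card hcover).trans ((card_union_le _ _).trans
    (Nat.add_le_add_left ((card_union_le _ _).trans
      (Nat.add_le_add_left card_biUnion_le _)) _))
  have h2 : (r : ℝ) ^ m ≤ #Z + (#{f : Fin m → P | ¬ Function.Injective f} +
      ∑ s, (#{f : Fin m → P | η * m <
        #{k | η * m ^ 2 < |∑ i, ∑ j, G s (f k) (f i) (f j)|}} : ℝ)) := by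
    have : (#(univ : Finset (Fin m → P)) : ℝ) = (r : ℝ) ^ m := by simp [hr]
    rw [← this]
    exact_mod_cast h1
  have h3 := card_not_injective_le (P := P) m
  have h4 := sum_le_card_nsmul univ _ _ fun s (_ : s ∈ univ) =>
    card_filter_deviation_le hm1 (G s) (hG s) (hK s) hη
  rw [← hr] at h3 h4
  have h5 : (m : ℝ) ^ 2 / r ≤ 1 / 4 := by
    rw [div_le_iff₀ hr0]
    have : (4 * m ^ 2 + 1 : ℝ) ≤ r := by exact_mod_cast hP
    linarith
  have h6 : (Fintype.card σ : ℝ) * (7 * K ^ 2 / (η ^ 3 * m)) ≤ 1 / 2 := by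
    rw [← div_div, mul_div_assoc', div_le_iff₀ hm']
    have : (m₀ : ℝ) + 1 ≤ m := by exact_mod_cast hm
    linarith
  have h7 := mul_le_mul_of_nonneg_right h5 (by positivity : (0 : ℝ) ≤ (r : ℝ) ^ m)
  have h8 := mul_le_mul_of_nonneg_right h6 (by positivity : (0 : ℝ) ≤ (r : ℝ) ^ m)
  rw [nsmul_eq_mul, card_univ, ← mul_assoc] at h4
  linarith

/-- A blown-up packing of a template replaces part of a matching by a larger one. -/
lemma exists_larger_matching {V P : Type} [DecidableEq V] [Fintype P] {H : Finset (Finset V)}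
    (N : Finset P)
    {τ : P → Fin 3 → V} (hτ : ∀ p a q b, τ p a = τ q b → p = q ∧ a = b)
    (hN : ∀ p ∈ N, univ.image (τ p) ∈ H) {m : ℕ} (R : Finset (Fin m))
    (X : Finset (Fin 3 → Fin m × Fin 3))
    (hX : ∀ x ∈ X, Function.Injective fun a => (x a).1) (cR : Fin m → ℕ)
    (cX : (Fin 3 → Fin m × Fin 3) → ℕ) {C : ℕ}
    (hC : ∀ v : Fin m × Fin 3, (if v.1 ∈ R then cR v.1 else 0) +
      ∑ x ∈ X with v ∈ Set.range x, cX x ≤ C)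
    (hlt : #R * C < ∑ i ∈ R, cR i + ∑ x ∈ X, cX x)
    (U : Fin m → Finset P) (hU : ∀ i, #(U i) = C) (hUU : ∀ i j, i ≠ j → Disjoint (U i) (U j))
    (hUN : ∀ i, i ∉ R → Disjoint (U i) N)
    (hUX : ∀ f : Fin m → P, (∀ i, f i ∈ U i) → ∀ x ∈ X,
      (univ.image fun a => τ (f (x a).1) (x a).2) ∈ H) :
    ∃ (J : Type) (_ : Fintype J) (g : J → Fin 3 → V),
      (∀ p a q b, g p a = g q b → p = q ∧ a = b) ∧ (∀ j, univ.image (g j) ∈ H) ∧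
      #N < Fintype.card J ∧ ∀ j a, ∃ p b, g j a = τ p b := by
  have hcR : ∀ i, (if i ∈ R then cR i else 0) ≤ #(U i) := fun i => by
    rw [hU]; exact (Nat.le_add_right _ _).trans (hC (i, 0))
  choose B hBU hB using fun i => exists_subset_card_eq (hcR i)
  let I := Σ x : X, Fin (cX x.1)
  let Iv : Fin m × Fin 3 → Finset I := fun v => {j | v ∈ Set.range j.1.1}
  have hmem : ∀ (j : I) a, j ∈ Iv (j.1.1 a) := fun j a => by simp [Iv]
  have hIv : ∀ v, #(Iv v) = ∑ x ∈ X with v ∈ Set.range x, cX x := by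
    intro v
    rw [show Iv v = (univ.filter fun x : X => v ∈ Set.range x.1).sigma fun x => univ by
      ext j
      exact ⟨fun h => Finset.mem_sigma.2 ⟨mem_filter.2 ⟨mem_univ _, (mem_filter.1 h).2⟩,
        mem_univ _⟩, fun h => mem_filter.2 ⟨mem_univ _,
        (mem_filter.1 (Finset.mem_sigma.1 h).1).2⟩⟩, card_sigma]
    simp only [card_univ, Fintype.card_fin]
    rw [sum_filter, sum_filter, ← sum_coe_sort X]
  have hφ : ∀ v, ∃ φ : I → P, (∀ j ∈ Iv v, φ j ∈ U v.1 \ B v.1) ∧ Set.InjOn φ (Iv v) := by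
    intro v
    have h1 : #(Iv v) ≤ #(U v.1 \ B v.1) := by
      rw [card_sdiff_of_subset (hBU _), hU, hB, hIv]
      have := hC v
      omega
    obtain ⟨T, hT, hTc⟩ := exists_subset_card_eq h1
    obtain ⟨e⟩ : Nonempty (Iv v ≃ T) := ⟨equivOfCardEq hTc.symm⟩
    rcases isEmpty_or_nonempty P with hP | hP
    · have hI : IsEmpty I := ⟨fun j => by
        have h2 : 0 < #(Iv (j.1.1 0)) := card_pos.2 ⟨j, hmem j 0⟩
        rw [hIv] at h2
        have h3 := (h2.trans_le (Nat.le_add_left _ _)).trans_le (hC _)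
        rw [← hU (j.1.1 0).1] at h3
        exact hP.false (card_pos.1 h3).choose⟩
      exact ⟨fun j => (hI.false j).elim, fun j => (hI.false j).elim, fun j => (hI.false j).elim⟩
    · refine ⟨fun j => if hj : j ∈ Iv v then e ⟨j, hj⟩ else Classical.arbitrary P,
        fun j hj => ?_, fun j hj j' hj' h => ?_⟩
      · simp only [hj, dif_pos]; exact hT (e ⟨j, hj⟩).2
      · rw [mem_coe] at hj hj'
        simp only [hj, hj', dif_pos] at h
        have := e.injective (Subtype.ext h)
        simpa using this
  choose φ hφU hφinj using hφ
  have hφm : ∀ (j : I) a, φ (j.1.1 a) j ∈ U (j.1.1 a).1 \ B (j.1.1 a).1 := fun j a =>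
    hφU _ _ (hmem j a)
  let N' : Finset P := N \ R.biUnion fun i => U i \ B i
  have hnot : ∀ (j : I) a, φ (j.1.1 a) j ∉ N' := by
    intro j a h
    rw [mem_sdiff, mem_biUnion] at h
    by_cases hR : (j.1.1 a).1 ∈ R
    · exact h.2 ⟨_, hR, hφm j a⟩
    · exact disjoint_left.1 (hUN _ hR) (mem_sdiff.1 (hφm j a)).1 h.1
  refine ⟨N' ⊕ I, inferInstance, Sum.elim (fun p a => τ p a)
    fun j a => τ (φ (j.1.1 a) j) (j.1.1 a).2, ?_, ?_, ?_, ?_⟩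
  · rintro (p | j) a (q | j') b h
    · have := hτ _ _ _ _ h
      exact ⟨congrArg _ (Subtype.ext this.1), this.2⟩
    · exact absurd ((hτ _ _ _ _ h).1 ▸ p.2) (hnot j' b)
    · exact absurd ((hτ _ _ _ _ h).1.symm ▸ q.2) (hnot j a)
    · obtain ⟨h1, h2⟩ := hτ _ _ _ _ h
      have h3 : (j.1.1 a).1 = (j'.1.1 b).1 := by
        by_contra hne
        exact disjoint_left.1 (hUU _ _ hne) (mem_sdiff.1 (hφm j a)).1
          (h1 ▸ (mem_sdiff.1 (hφm j' b)).1)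
      have h4 : j.1.1 a = j'.1.1 b := Prod.ext h3 h2
      have h5 : j = j' := by
        refine hφinj (j.1.1 a) (hmem j a) ?_ ?_
        · rw [h4]; exact hmem j' b
        · rw [h1, h4]
      subst h5
      refine ⟨rfl, hX _ j.1.2 ?_⟩
      simp only [h4]
  · rintro (p | j)
    · exact hN _ (mem_sdiff.1 p.2).1
    · have hne : ∀ i, (U i).Nonempty := fun i => by
        rw [← card_pos, hU]
        have h1 := hmem j 0
        have h2 : 0 < #(Iv (j.1.1 0)) := card_pos.2 ⟨_, h1⟩
        rw [hIv] at h2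
        exact (h2.trans_le (Nat.le_add_left _ _)).trans_le (hC _)
      choose d hd using hne
      have hinj := hX _ j.1.2
      have := hUX (Function.extend (fun a => (j.1.1 a).1) (fun a => φ (j.1.1 a) j) d) (fun i => by
        by_cases hi : ∃ a, (j.1.1 a).1 = i
        · obtain ⟨a, rfl⟩ := hi
          rw [hinj.extend_apply (fun a => φ (j.1.1 a) j)]
          exact (mem_sdiff.1 (hφm j a)).1
        · rw [Function.extend_apply' _ _ _ hi]
          exact hd i) j.1.1 j.1.2
      simp only [hinj.extend_apply (fun a => φ (j.1.1 a) j)] at this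
      exact this
  · have hI : Fintype.card I = ∑ x ∈ X, cX x := by
      rw [Fintype.card_sigma, ← sum_coe_sort X]
      simp
    have h1 : #(R.biUnion fun i => U i \ B i) ≤ ∑ i ∈ R, (C - cR i) := by
      refine card_biUnion_le.trans (sum_le_sum fun i hi => ?_)
      rw [card_sdiff_of_subset (hBU _), hU, hB, if_pos hi]
    have h2 : ∑ i ∈ R, (C - cR i) + ∑ i ∈ R, cR i = #R * C := by
      rw [← sum_add_distrib, ← smul_eq_mul, ← sum_const]
      refine sum_congr rfl fun i hi => Nat.sub_add_cancel ?_
      have := hcR i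
      rwa [if_pos hi, hU] at this
    have h3 := le_card_sdiff (R.biUnion fun i => U i \ B i) N
    rw [Fintype.card_sum, hI, Fintype.card_coe]
    simp only [N']
    omega
  · rintro (p | j) a
    · exact ⟨_, _, rfl⟩
    · exact ⟨_, _, rfl⟩

/-- Linear programming duality for a template whose edges are the triples `{i} × Fin 3` with
`i ∈ R` and the triples in `X`. -/
lemma template_packing_or_cover {m : ℕ} (R : Finset (Fin m))
    (X : Finset (Fin 3 → Fin m × Fin 3)) (hX : ∀ x ∈ X, Function.Injective fun a => (x a).1) :
    (∃ (cR : Fin m → ℕ) (cX : (Fin 3 → Fin m × Fin 3) → ℕ) (C : ℕ),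
      (∀ v : Fin m × Fin 3, (if v.1 ∈ R then cR v.1 else 0) +
        ∑ x ∈ X with v ∈ Set.range x, cX x ≤ C) ∧
      #R * C < ∑ i ∈ R, cR i + ∑ x ∈ X, cX x) ∨
    ∃ w : Fin m → Fin 3 → ℝ, (∀ i a, 0 ≤ w i a) ∧ (∀ i ∈ R, 1 ≤ ∑ a, w i a) ∧
      (∀ x ∈ X, 1 ≤ ∑ a, w (x a).1 (x a).2) ∧ ∑ i, ∑ a, w i a ≤ #R := by
  let E : R ⊕ X → Fin m × Fin 3 → ℕ := Sum.elim (fun i v => if v.1 = i then 1 else 0)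
    fun x v => if v ∈ Set.range x.1 then 1 else 0
  rcases exists_packing_or_cover E #R with ⟨c, C, hC, hlt⟩ | ⟨w, hw0, hw1, hw⟩
  · left
    refine ⟨fun i => if h : i ∈ R then c (Sum.inl ⟨i, h⟩) else 0,
      fun x => if h : x ∈ X then c (Sum.inr ⟨x, h⟩) else 0, C, fun v => ?_, ?_⟩
    · refine le_trans (le_of_eq ?_) (hC v)
      rw [Fintype.sum_sum_type]
      congr 1
      · simp only [E, Sum.elim_inl]
        split_ifs with h
        · rw [sum_eq_single ⟨v.1, h⟩]
          · simp
          · intro b _ hb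
            rw [if_neg, mul_zero]
            exact fun h' => hb (Subtype.ext h'.symm)
          · simp
        · symm
          refine sum_eq_zero fun i _ => ?_
          rw [if_neg, mul_zero]
          exact fun h' => h (h' ▸ i.2)
      · rw [sum_filter, ← sum_coe_sort X]
        refine sum_congr rfl fun x _ => ?_
        simp [E]
    · rw [Fintype.sum_sum_type] at hlt
      convert hlt using 2
      · rw [← sum_coe_sort R]
        exact sum_congr rfl fun x _ => by simp
      · rw [← sum_coe_sort X]
        exact sum_congr rfl fun x _ => by simp
  · right
    refine ⟨fun i a => w (i, a), fun i a => hw0 _, fun i hi => ?_, fun x hx => ?_, ?_⟩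
    · refine (hw1 (Sum.inl ⟨i, hi⟩)).trans_eq ?_
      rw [Fintype.sum_prod_type, sum_eq_single i]
      · simp [E]
      · intro b _ hb
        simp [E, hb]
      · simp
    · refine (hw1 (Sum.inr ⟨x, hx⟩)).trans_eq ?_
      have hinj : Function.Injective x := fun a b h => hX x hx (by simp only [h])
      have : ∑ a, w (x a) = ∑ v ∈ univ.image x, w v := (sum_image fun a _ b _ h => hinj h).symm
      rw [show ∑ a, w ((x a).1, (x a).2) = ∑ a, w (x a) from rfl, this]
      simp only [E, Sum.elim_inr, Nat.cast_ite, Nat.cast_one, Nat.cast_zero, ite_mul, one_mul,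
        zero_mul]
      rw [← sum_filter]
      refine sum_congr ?_ fun _ _ => rfl
      ext v
      simp
    · rwa [Fintype.sum_prod_type] at hw

lemma isWeightTriple_of_cover {m : ℕ} {R : Finset (Fin m)} {w : Fin m → Fin 3 → ℝ}
    (hw0 : ∀ i a, 0 ≤ w i a) (hwR : ∀ i ∈ R, 1 ≤ ∑ a, w i a) (hw : ∑ i, ∑ a, w i a ≤ #R) :
    (∀ i, IsWeightTriple (w i)) ∧ ∀ i ∉ R, ∀ a, w i a = 0 := by
  have h0 : ∀ i, 0 ≤ ∑ a, w i a := fun i => sum_nonneg fun a _ => hw0 i a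
  have h1 : ∑ i, (∑ a, w i a - if i ∈ R then 1 else 0) ≤ 0 := by
    rw [sum_sub_distrib]
    simp [hw]
  have h2 : ∀ i, 0 ≤ ∑ a, w i a - if i ∈ R then 1 else 0 := by
    intro i
    split_ifs with h
    · linarith [hwR i h]
    · linarith [h0 i]
  have h3 : ∀ i, ∑ a, w i a - (if i ∈ R then 1 else 0) = 0 := fun i =>
    (sum_eq_zero_iff_of_nonneg fun i _ => h2 i).1 (le_antisymm h1 (sum_nonneg fun i _ => h2 i)) i
      (mem_univ i)
  refine ⟨fun i => ⟨hw0 i, ?_⟩, fun i hi a => ?_⟩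
  · have := h3 i
    split_ifs at this <;> linarith
  · have := h3 i
    rw [if_neg hi, sub_zero] at this
    exact (sum_eq_zero_iff_of_nonneg fun a _ => hw0 i a).1 this a (mem_univ a)

/-- Number of pairs in `τ p × τ q` which form an edge together with `z`. -/
def linkCount {V P : Type} [DecidableEq V] (H : Finset (Finset V)) (τ : P → Fin 3 → V) (z : V)
    (p q : P) : ℝ :=
  ∑ b, ∑ c, if {z, τ p b, τ q c} ∈ H then 1 else 0

lemma linkCount_nonneg {V P : Type} [DecidableEq V] (H : Finset (Finset V)) (τ : P → Fin 3 → V)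
    (z : V) (p q : P) :
    0 ≤ linkCount H τ z p q :=
  sum_nonneg fun _ _ => sum_nonneg fun _ _ => by split_ifs <;> norm_num

lemma linkCount_le {V P : Type} [DecidableEq V] (H : Finset (Finset V)) (τ : P → Fin 3 → V) (z : V)
    (p q : P) :
    linkCount H τ z p q ≤ 9 := by
  have : linkCount H τ z p q ≤ ∑ _b : Fin 3, ∑ _c : Fin 3, 1 :=
    sum_le_sum fun _ _ => sum_le_sum fun _ _ => by split_ifs <;> norm_num
  refine this.trans_eq ?_
  norm_num

lemma heavyPairs_nonneg (c : ℝ) (e f : Fin 3 → ℝ) : 0 ≤ heavyPairs c e f :=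
  sum_nonneg fun _ _ => sum_nonneg fun _ _ => by split_ifs <;> norm_num

/-- The crossing edges induced on the triples indexed by `f`. -/
def crossingEdges {V P : Type} [DecidableEq V] (H : Finset (Finset V)) (τ : P → Fin 3 → V) {m : ℕ}
    (f : Fin m → P) : Finset (Fin 3 → Fin m × Fin 3) :=
  {x | (Function.Injective fun a => (x a).1) ∧
    (univ.image fun a => τ (f (x a).1) (x a).2) ∈ H}

lemma sum_linkCount_le_sum_heavyPairs {V P : Type} [DecidableEq V] {H : Finset (Finset V)}
    {τ : P → Fin 3 → V}
    {m : ℕ} {f : Fin m → P} {w : Fin m → Fin 3 → ℝ}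
    (hw : ∀ x ∈ crossingEdges H τ f, 1 ≤ ∑ a, w (x a).1 (x a).2) (k : Fin m) (a : Fin 3) :
    ∑ i, ∑ j, linkCount H τ (τ (f k) a) (f i) (f j) ≤
      ∑ i, ∑ j, heavyPairs (w k a) (w i) (w j) + 27 * m := by
  have h1 : ∀ i j, linkCount H τ (τ (f k) a) (f i) (f j) ≤ heavyPairs (w k a) (w i) (w j) +
      9 * ((if i = j then 1 else 0) + (if i = k then 1 else 0) + (if j = k then 1 else 0)) := by
    intro i j
    have hh := heavyPairs_nonneg (w k a) (w i) (w j)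
    have hl := linkCount_le H τ (τ (f k) a) (f i) (f j)
    by_cases hij : i = j
    · rw [if_pos hij]; split_ifs <;> linarith
    by_cases hik : i = k
    · rw [if_pos hik]; split_ifs <;> linarith
    by_cases hjk : j = k
    · rw [if_pos hjk]; split_ifs; linarith
    rw [if_neg hij, if_neg hik, if_neg hjk]
    simp only [add_zero, mul_zero]
    refine sum_le_sum fun b _ => sum_le_sum fun c _ => ?_
    by_cases he : {τ (f k) a, τ (f i) b, τ (f j) c} ∈ H
    · have := hw ![(k, a), (i, b), (j, c)] (by
        rw [crossingEdges, mem_filter]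
        refine ⟨mem_univ _, ?_, ?_⟩
        · intro s t
          fin_cases s <;> fin_cases t <;> simp [hij, hik, hjk, Ne.symm hij, Ne.symm hik,
            Ne.symm hjk, eq_comm]
        · convert he using 1
          ext z
          simp [Fin.exists_fin_succ, eq_comm])
      rw [Fin.sum_univ_three] at this
      simp only [Matrix.cons_val_zero, Matrix.cons_val_one, Matrix.cons_val] at this
      rw [if_pos he, if_pos this]
    · rw [if_neg he]; split_ifs <;> norm_num
  refine (sum_le_sum fun i _ => sum_le_sum fun j _ => h1 i j).trans_eq ?_
  simp only [sum_add_distrib, ← mul_sum, sum_ite_eq, mem_univ, if_true, sum_const, card_univ,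
    Fintype.card_fin, nsmul_eq_mul, mul_ite, mul_one, mul_zero, sum_ite_eq']
  ring

/-- The mean of `linkCount H τ z` over all pairs. -/
def meanLink {V P : Type} [DecidableEq V] [Fintype P] (H : Finset (Finset V)) (τ : P → Fin 3 → V)
    (z : V) : ℝ :=
  (∑ p, ∑ q, linkCount H τ z p q) / (Fintype.card P : ℝ) ^ 2

/-- Number of vertices of the triple `e` outside `A`. -/
def missCount {V : Type} [DecidableEq V] (A : Finset V) (e : Fin 3 → V) : ℝ :=
  ∑ a, if e a ∈ A then 0 else 1

/-- The quantities whose concentration along a random injection is used. -/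
def statistic {V P : Type} [DecidableEq V] [Fintype P] (H : Finset (Finset V)) (τ : P → Fin 3 → V)
    (u : Fin 3 → P → ℝ) : Fin 3 ⊕ Fin 3 → P → P → P → ℝ
  | Sum.inl a, v, p, q => linkCount H τ (τ v a) p q - meanLink H τ (τ v a)
  | Sum.inr s, _, p, _ => u s p - (∑ x, u s x) / Fintype.card P

lemma sum_statistic {V P : Type} [DecidableEq V] [Fintype P] (H : Finset (Finset V))
    (τ : P → Fin 3 → V)
    (u : Fin 3 → P → ℝ) (s : Fin 3 ⊕ Fin 3) (v : P) : ∑ p, ∑ q, statistic H τ u s v p q = 0 := by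
  have hr : (Fintype.card P : ℝ) ≠ 0 := by
    have : Nonempty P := ⟨v⟩
    exact_mod_cast Fintype.card_ne_zero
  rcases s with a | s
  · simp only [statistic, sum_sub_distrib, sum_const, card_univ, nsmul_eq_mul, meanLink]
    field_simp
    ring
  · simp only [statistic, sum_sub_distrib, sum_const, card_univ, nsmul_eq_mul, ← mul_sum]
    field_simp
    ring

lemma abs_statistic_le {V P : Type} [DecidableEq V] [Fintype P] (H : Finset (Finset V))
    (τ : P → Fin 3 → V)
    {u : Fin 3 → P → ℝ} (hu : ∀ s p, 0 ≤ u s p ∧ u s p ≤ 3) (s : Fin 3 ⊕ Fin 3) (v p q : P) :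
    |statistic H τ u s v p q| ≤ 9 := by
  have hr : (0 : ℝ) < Fintype.card P := by
    have : Nonempty P := ⟨v⟩
    exact_mod_cast Fintype.card_pos
  rcases s with a | s
  · have h1 := linkCount_nonneg H τ (τ v a)
    have h2 := linkCount_le H τ (τ v a)
    have h3 : 0 ≤ meanLink H τ (τ v a) :=
      div_nonneg (sum_nonneg fun _ _ => sum_nonneg fun _ _ => h1 _ _) (by positivity)
    have h4 : meanLink H τ (τ v a) ≤ 9 := by
      rw [meanLink, div_le_iff₀ (by positivity)]
      refine (sum_le_sum fun p _ => sum_le_sum fun q _ => h2 p q).trans_eq ?_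
      simp only [sum_const, card_univ, nsmul_eq_mul]
      ring
    simp only [statistic]
    exact abs_sub_le_of_nonneg_of_le (h1 p q) (h2 p q) h3 h4
  · have h3 : 0 ≤ (∑ x, u s x) / Fintype.card P :=
      div_nonneg (sum_nonneg fun x _ => (hu s x).1) hr.le
    have h4 : (∑ x, u s x) / Fintype.card P ≤ 3 := by
      rw [div_le_iff₀ hr]
      refine (sum_le_sum fun x _ => (hu s x).2).trans_eq ?_
      simp only [sum_const, card_univ, nsmul_eq_mul]
      ring
    simp only [statistic]
    exact (abs_sub_le_of_nonneg_of_le (hu s p).1 (hu s p).2 h3 h4).trans (by norm_num)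

/-- The linear statistics: vertices outside `A`, vertices outside `B`, triples outside `N`. -/
def linearStatistic {V P : Type} [DecidableEq V] (A B : Finset V) (N : Finset P)
    (τ : P → Fin 3 → V) :
    Fin 3 → P → ℝ :=
  ![fun p => missCount A (τ p), fun p => missCount B (τ p), fun p => if p ∈ N then 0 else 1]

lemma missCount_mem_Icc {V : Type} [DecidableEq V] (A : Finset V) (e : Fin 3 → V) :
    0 ≤ missCount A e ∧ missCount A e ≤ 3 := by
  unfold missCount
  rw [Fin.sum_univ_three]
  split_ifs <;> norm_num

lemma linearStatistic_mem_Icc {V P : Type} [DecidableEq V] (A B : Finset V) (N : Finset P)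
    (τ : P → Fin 3 → V)
    (s : Fin 3) (p : P) : 0 ≤ linearStatistic A B N τ s p ∧ linearStatistic A B N τ s p ≤ 3 := by
  fin_cases s
  · exact missCount_mem_Icc _ _
  · exact missCount_mem_Icc _ _
  · simp only [linearStatistic]
    change 0 ≤ (if p ∈ N then (0 : ℝ) else 1) ∧ (if p ∈ N then (0 : ℝ) else 1) ≤ 3
    split_ifs <;> norm_num

lemma card_compl_filter_le {V P : Type} [DecidableEq V] (A : Finset V) (τ : P → Fin 3 → V) {m : ℕ}
    (f : Fin m → P)
    (Y : Fin 3 → Finset (Fin m)) {ξ : ℝ} (hY : ∀ a, (#(Y a) : ℝ) ≤ ξ) :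
    (#({v : Fin m × Fin 3 | τ (f v.1) v.2 ∈ A ∧ v.1 ∉ Y v.2} : Finset (Fin m × Fin 3))ᶜ : ℝ) ≤
      ∑ k, missCount A (τ (f k)) + 3 * ξ := by
  have h1 : (#({v : Fin m × Fin 3 | τ (f v.1) v.2 ∈ A ∧ v.1 ∉ Y v.2} :
      Finset (Fin m × Fin 3))ᶜ : ℝ) = ∑ v : Fin m × Fin 3,
      if ¬ (τ (f v.1) v.2 ∈ A ∧ v.1 ∉ Y v.2) then (1 : ℝ) else 0 := by
    rw [sum_boole, compl_filter]
  have h2 : ∑ a, (#(Y a) : ℝ) ≤ 3 * ξ := by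
    refine (sum_le_sum fun a _ => hY a).trans_eq ?_
    simp
  have h3 : ∑ a, (#(Y a) : ℝ) = ∑ k : Fin m, ∑ a, if k ∈ Y a then (1 : ℝ) else 0 := by
    rw [sum_comm]
    refine sum_congr rfl fun a _ => ?_
    rw [sum_boole]
    simp
  rw [h1, Fintype.sum_prod_type]
  refine le_trans ?_ (add_le_add_right h2 _)
  rw [h3, ← sum_add_distrib]
  refine sum_le_sum fun k _ => ?_
  rw [missCount, ← sum_add_distrib]
  refine sum_le_sum fun a _ => ?_
  by_cases h4 : τ (f k) a ∈ A <;> by_cases h5 : k ∈ Y a <;> simp [h4, h5]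

lemma false_of_concentrated {γ ξ η : ℝ} (hξ : 0 < ξ) (hη : 0 ≤ η) (hξγ : η + 4 * ξ < γ)
    (hη' : η + 4 * ξ ≤ 1 / 1000) (hξ' : ξ ≤ 1 / 50000) {m : ℕ} (hm : 0 < m) (hmγ : 27 ≤ γ * m)
    {V P : Type} [DecidableEq V] [Fintype P]
    {H : Finset (Finset V)} {τ : P → Fin 3 → V} {A B : Finset V} {N : Finset P}
    (hA : ∀ p a, τ p a ∈ A → 5 + 3 * γ ≤ meanLink H τ (τ p a))
    (hB : ∀ p a, τ p a ∈ B → 4 + 3 * γ ≤ meanLink H τ (τ p a))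
    (hdeg : ∀ p a, 3 + 3 * γ ≤ meanLink H τ (τ p a))
    (hAc : ∑ p, missCount A (τ p) ≤ (1 + η) * Fintype.card P)
    (hBc : ∑ p, missCount B (τ p) ≤ 0.5509 * Fintype.card P)
    (hN : 3 * ξ * Fintype.card P ≤ ∑ p, if p ∈ N then 0 else 1)
    {f : Fin m → P}
    (hf : ∀ s, (#{k | ξ * m ^ 2 < |∑ i, ∑ j, statistic H τ (linearStatistic A B N τ) s
      (f k) (f i) (f j)|} : ℝ) ≤ ξ * m)
    {w : Fin m → Fin 3 → ℝ} (hw0 : ∀ i a, 0 ≤ w i a)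
    (hwR : ∀ i ∈ ({i | f i ∈ N} : Finset (Fin m)), 1 ≤ ∑ a, w i a)
    (hwX : ∀ x ∈ crossingEdges H τ f, 1 ≤ ∑ a, w (x a).1 (x a).2)
    (hw : ∑ i, ∑ a, w i a ≤ #({i | f i ∈ N} : Finset (Fin m))) : False := by
  obtain ⟨hwt, hwz⟩ := isWeightTriple_of_cover hw0 hwR hw
  have hm' : (0 : ℝ) < m := by exact_mod_cast hm
  have hr : (0 : ℝ) < Fintype.card P := by
    have : Nonempty P := ⟨f ⟨0, hm⟩⟩
    exact_mod_cast Fintype.card_pos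
  have hlin : ∀ s, |∑ i, linearStatistic A B N τ s (f i) -
      m * ((∑ x, linearStatistic A B N τ s x) / Fintype.card P)| ≤ ξ * m := by
    intro s
    by_contra! h
    have h1 := hf (Sum.inr s)
    have h2 : ∀ k : Fin m, ξ * m ^ 2 < |∑ i, ∑ j, statistic H τ (linearStatistic A B N τ)
        (Sum.inr s) (f k) (f i) (f j)| := by
      intro k
      simp only [statistic, sum_const, card_univ, Fintype.card_fin, nsmul_eq_mul, ← mul_sum,
        sum_sub_distrib]
      rw [abs_mul, abs_of_pos hm']
      nlinarith
    rw [filter_true_of_mem fun k _ => h2 k, card_univ, Fintype.card_fin] at h1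
    nlinarith
  let Y : Fin 3 → Finset (Fin m) := fun a => {k | ξ * m ^ 2 < |∑ i, ∑ j, statistic H τ
    (linearStatistic A B N τ) (Sum.inl a) (f k) (f i) (f j)|}
  have hY : ∀ a, (#(Y a) : ℝ) ≤ ξ * m := fun a => hf (Sum.inl a)
  have hgood : ∀ (k : Fin m) (a : Fin 3) (c : ℝ), k ∉ Y a →
      c + 3 * γ ≤ meanLink H τ (τ (f k) a) →
      (c + γ) * (m : ℝ) ^ 2 ≤ ∑ i, ∑ j, heavyPairs (w k a) (w i) (w j) := by
    intro k a c hk hc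
    have h1 : |∑ i, ∑ j, statistic H τ (linearStatistic A B N τ) (Sum.inl a)
        (f k) (f i) (f j)| ≤ ξ * m ^ 2 := by
      simpa [Y] using hk
    simp only [statistic, sum_const, card_univ, Fintype.card_fin, nsmul_eq_mul,
        sum_sub_distrib] at h1
    have h2 := (abs_le.1 h1).1
    have h3 := sum_linkCount_le_sum_heavyPairs hwX k a
    have h4 : (c + 3 * γ) * m ^ 2 ≤ meanLink H τ (τ (f k) a) * m ^ 2 :=
      mul_le_mul_of_nonneg_right hc (by positivity)
    have h5 : 27 * (m : ℝ) ≤ γ * m ^ 2 := by nlinarith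
    have h6 : ξ * (m : ℝ) ^ 2 ≤ γ * m ^ 2 :=
      mul_le_mul_of_nonneg_right (by linarith) (by positivity)
    nlinarith
  have hmean : ∀ s c, ∑ x, linearStatistic A B N τ s x ≤ c * Fintype.card P →
      ∑ i, linearStatistic A B N τ s (f i) ≤ (c + ξ) * m := by
    intro s c h
    have h1 := (abs_le.1 (hlin s)).2
    have h2 : (∑ x, linearStatistic A B N τ s x) / Fintype.card P ≤ c := (div_le_iff₀ hr).2 h
    nlinarith
  obtain ⟨k, hkN, hkY⟩ : ∃ k, f k ∉ N ∧ k ∉ Y 0 := by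
    by_contra! h
    have h1 := (abs_le.1 (hlin 2)).1
    have h2 : 3 * ξ ≤ (∑ x, linearStatistic A B N τ 2 x) / Fintype.card P :=
      (le_div_iff₀ hr).2 hN
    have h3 : ∑ i, linearStatistic A B N τ 2 (f i) ≤ #(Y 0) := by
      have : (#(Y 0) : ℝ) = ∑ k : Fin m, if k ∈ Y 0 then (1 : ℝ) else 0 := by
        rw [sum_boole]; simp
      rw [this]
      refine sum_le_sum fun i _ => ?_
      change (if f i ∈ N then (0 : ℝ) else 1) ≤ _
      by_cases hi : f i ∈ N
      · rw [if_pos hi]; split_ifs <;> norm_num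
      · rw [if_neg hi, if_pos (h i hi)]
    have h4 := hY 0
    have h5 : m * (3 * ξ) ≤ m * ((∑ x, linearStatistic A B N τ 2 x) / Fintype.card P) :=
      mul_le_mul_of_nonneg_left h2 hm'.le
    have h6 : 0 < ξ * m := by positivity
    linarith
  have hcA : ∑ k, missCount A (τ (f k)) ≤ (1 + η + ξ) * m := hmean 0 _ hAc
  have hcB : ∑ k, missCount B (τ (f k)) ≤ (0.5509 + ξ) * m := hmean 1 _ hBc
  refine false_of_weighting (η := η + 4 * ξ) (by linarith) hξγ hη' hm hwt
    (S := {v | τ (f v.1) v.2 ∈ A ∧ v.1 ∉ Y v.2}) (F := {v | τ (f v.1) v.2 ∈ B ∧ v.1 ∉ Y v.2})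
    ?_ ?_ (fun v hv => ?_) (fun v hv => ?_) (v₀ := (k, 0)) (hwz k (by simpa using hkN) 0)
    (hgood _ _ _ hkY (hdeg _ _))
  · refine (card_compl_filter_le A τ f Y hY).trans ?_
    linarith
  · refine (card_compl_filter_le B τ f Y hY).trans ?_
    nlinarith
  · have hv := (mem_filter.1 hv).2
    exact hgood _ _ _ hv.2 (hA _ _ hv.1)
  · have hv := (mem_filter.1 hv).2
    exact hgood _ _ _ hv.2 (hB _ _ hv.1)

/-- A dense family of copies of a template without fractional cover yields a larger matching. -/
lemma exists_larger_of_template {m : ℕ} (R : Finset (Fin m))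
    (X : Finset (Fin 3 → Fin m × Fin 3)) {δ : ℝ} (hδ : 0 < δ)
    (hX : ∀ x ∈ X, Function.Injective fun a => (x a).1)
    (hno : ¬ ∃ w : Fin m → Fin 3 → ℝ, (∀ i a, 0 ≤ w i a) ∧ (∀ i ∈ R, 1 ≤ ∑ a, w i a) ∧
      (∀ x ∈ X, 1 ≤ ∑ a, w (x a).1 (x a).2) ∧ ∑ i, ∑ a, w i a ≤ #R) :
    ∃ r₀ : ℕ, ∀ (V P : Type) [DecidableEq V] [Fintype P], r₀ ≤ Fintype.card P →
      ∀ (H : Finset (Finset V)) (N : Finset P) (τ : P → Fin 3 → V),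
      (∀ p a q b, τ p a = τ q b → p = q ∧ a = b) → (∀ p ∈ N, univ.image (τ p) ∈ H) →
      ∀ 𝓕 : Finset (Fin m → P), δ * (Fintype.card P : ℝ) ^ m ≤ #𝓕 →
      (∀ f ∈ 𝓕, Function.Injective f ∧ ({i | f i ∈ N} : Finset (Fin m)) = R ∧
        crossingEdges H τ f = X) →
      ∃ (J : Type) (_ : Fintype J) (g : J → Fin 3 → V),
        (∀ p a q b, g p a = g q b → p = q ∧ a = b) ∧ (∀ j, univ.image (g j) ∈ H) ∧
        #N < Fintype.card J ∧ ∀ j a, ∃ p b, g j a = τ p b := by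
  obtain ⟨cR, cX, C, hC, hlt⟩ := (template_packing_or_cover R X hX).resolve_right hno
  obtain ⟨r₀, hr₀⟩ := exists_complete_partite C m δ hδ
  refine ⟨r₀, fun V P _ _ hP H N τ hτ hN 𝓕 h𝓕 hF => ?_⟩
  obtain ⟨U, hU, hUF⟩ := hr₀ P hP 𝓕 h𝓕
  have hne : ∀ i, (U i).Nonempty → ∀ j, (U j).Nonempty := fun i hi j => by
    rw [← card_pos] at hi ⊢
    rwa [hU] at hi ⊢
  refine exists_larger_matching N hτ hN R X hX cR cX hC hlt U hU (fun i j hij => ?_)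
    (fun i hi => ?_) (fun f hf x hx => ?_)
  · rw [disjoint_left]
    intro p hpi hpj
    choose d hd using hne i ⟨p, hpi⟩
    have h := hF _ (hUF (Function.update (Function.update d i p) j p) fun l => by
      rcases eq_or_ne l j with rfl | hlj
      · simpa using hpj
      rw [Function.update_of_ne hlj]
      rcases eq_or_ne l i with rfl | hli
      · simpa using hpi
      rw [Function.update_of_ne hli]
      exact hd l)
    refine hij (h.1 ?_)
    rw [Function.update_of_ne hij, Function.update_self, Function.update_self]
  · rw [disjoint_left]
    intro p hpi hpN
    choose d hd using hne i ⟨p, hpi⟩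
    have h := hF _ (hUF (Function.update d i p) fun l => by
      rcases eq_or_ne l i with rfl | hli
      · simpa using hpi
      rw [Function.update_of_ne hli]
      exact hd l)
    apply hi
    rw [← h.2.1, mem_filter]
    simpa using hpN
  · have h := hF f (hUF f hf)
    rw [← h.2.2, crossingEdges, mem_filter] at hx
    exact hx.2.2

/-- Degree conditions allow to enlarge any matching leaving a positive proportion uncovered. -/
lemma exists_larger_of_meanLink {γ ξ η : ℝ} (hξ : 0 < ξ) (hη : 0 ≤ η) (hξγ : η + 4 * ξ < γ)
    (hη' : η + 4 * ξ ≤ 1 / 1000) (hξ' : ξ ≤ 1 / 50000) :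
    ∃ r₀ : ℕ, ∀ (V P : Type) [DecidableEq V] [Fintype P], r₀ ≤ Fintype.card P →
      ∀ (H : Finset (Finset V)) (N : Finset P) (τ : P → Fin 3 → V) (A B : Finset V),
      (∀ p a q b, τ p a = τ q b → p = q ∧ a = b) → (∀ p ∈ N, univ.image (τ p) ∈ H) →
      (∀ p a, τ p a ∈ A → 5 + 3 * γ ≤ meanLink H τ (τ p a)) →
      (∀ p a, τ p a ∈ B → 4 + 3 * γ ≤ meanLink H τ (τ p a)) →
      (∀ p a, 3 + 3 * γ ≤ meanLink H τ (τ p a)) →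
      ∑ p, missCount A (τ p) ≤ (1 + η) * Fintype.card P →
      ∑ p, missCount B (τ p) ≤ 0.5509 * Fintype.card P →
      3 * ξ * Fintype.card P ≤ (∑ p, if p ∈ N then 0 else 1 : ℝ) →
      ∃ (J : Type) (_ : Fintype J) (g : J → Fin 3 → V),
        (∀ p a q b, g p a = g q b → p = q ∧ a = b) ∧ (∀ j, univ.image (g j) ∈ H) ∧
        #N < Fintype.card J ∧ ∀ j a, ∃ p b, g j a = τ p b := by
  obtain ⟨m₀, hm₀⟩ := exists_forall_concentrated (Fin 3 ⊕ Fin 3) 9 hξ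
  have hγ : 0 < γ := by linarith
  obtain ⟨m₁, hm₁⟩ := exists_nat_gt (27 / γ)
  let m := max m₀ (m₁ + 1)
  have hm : 0 < m := by simp only [m]; omega
  have hmγ : 27 ≤ γ * m := by
    rw [div_lt_iff₀ hγ] at hm₁
    have : (m₁ : ℝ) ≤ m := by exact_mod_cast (by simp only [m]; omega : m₁ ≤ m)
    nlinarith
  obtain ⟨r₁, hr₁⟩ := hm₀ m (le_max_left _ _)
  let T := Finset (Fin m) × Finset (Fin 3 → Fin m × Fin 3)
  have hT : (0 : ℝ) < Fintype.card T := by exact_mod_cast Fintype.card_pos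
  let δ : ℝ := 1 / 4 / Fintype.card T
  have hδ : 0 < δ := by positivity
  have key : ∀ t : T, ∃ r₀ : ℕ, (∀ x ∈ t.2, Function.Injective fun a => (x a).1) →
      (¬ ∃ w : Fin m → Fin 3 → ℝ, (∀ i a, 0 ≤ w i a) ∧ (∀ i ∈ t.1, 1 ≤ ∑ a, w i a) ∧
      (∀ x ∈ t.2, 1 ≤ ∑ a, w (x a).1 (x a).2) ∧ ∑ i, ∑ a, w i a ≤ #t.1) →
      ∀ (V P : Type) [DecidableEq V] [Fintype P], r₀ ≤ Fintype.card P →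
      ∀ (H : Finset (Finset V)) (N : Finset P) (τ : P → Fin 3 → V),
      (∀ p a q b, τ p a = τ q b → p = q ∧ a = b) → (∀ p ∈ N, univ.image (τ p) ∈ H) →
      ∀ 𝓕 : Finset (Fin m → P), δ * (Fintype.card P : ℝ) ^ m ≤ #𝓕 →
      (∀ f ∈ 𝓕, Function.Injective f ∧ ({i | f i ∈ N} : Finset (Fin m)) = t.1 ∧
        crossingEdges H τ f = t.2) →
      ∃ (J : Type) (_ : Fintype J) (g : J → Fin 3 → V),
        (∀ p a q b, g p a = g q b → p = q ∧ a = b) ∧ (∀ j, univ.image (g j) ∈ H) ∧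
        #N < Fintype.card J ∧ ∀ j a, ∃ p b, g j a = τ p b := by
    intro t
    by_cases h1 : ∀ x ∈ t.2, Function.Injective fun a => (x a).1
    · by_cases h2 : ∃ w : Fin m → Fin 3 → ℝ, (∀ i a, 0 ≤ w i a) ∧ (∀ i ∈ t.1, 1 ≤ ∑ a, w i a) ∧
        (∀ x ∈ t.2, 1 ≤ ∑ a, w (x a).1 (x a).2) ∧ ∑ i, ∑ a, w i a ≤ #t.1
      · exact ⟨0, fun _ h => absurd h2 h⟩
      · obtain ⟨r₀, hr₀⟩ := exists_larger_of_template t.1 t.2 hδ h1 h2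
        exact ⟨r₀, fun _ _ => hr₀⟩
    · exact ⟨0, fun h => absurd h h1⟩
  choose ρ hρ using key
  refine ⟨max (r₁ + 1) (univ.sup ρ), fun V P _ _ hP H N τ A B hτ hN hA hB hdeg hAc hBc hNc => ?_⟩
  have hP₁ : r₁ + 1 ≤ Fintype.card P := (le_max_left _ _).trans hP
  have hr : (0 : ℝ) < Fintype.card P := by exact_mod_cast (by omega : 0 < Fintype.card P)
  have hZ := hr₁ P (by omega) (statistic H τ (linearStatistic A B N τ)) (sum_statistic _ _ _)
    (abs_statistic_le _ _ (linearStatistic_mem_Icc A B N τ))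
  set Z : Finset (Fin m → P) := {f : Fin m → P | Function.Injective f ∧
    ∀ s, (#{k | ξ * m ^ 2 < |∑ i, ∑ j, statistic H τ (linearStatistic A B N τ) s
      (f k) (f i) (f j)|} : ℝ) ≤ ξ * m} with hZdef
  obtain ⟨t, -, ht⟩ := exists_le_card_fiber_of_nsmul_le_card_of_maps_to
    (s := Z) (t := (univ : Finset T))
    (f := fun f => (({i | f i ∈ N} : Finset (Fin m)), crossingEdges H τ f))
    (b := δ * (Fintype.card P : ℝ) ^ m) (fun f _ => mem_univ _) univ_nonempty (by
      rw [card_univ, nsmul_eq_mul, ← mul_assoc, mul_div_cancel₀ _ hT.ne']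
      exact hZ)
  have hne : #{f ∈ Z | (({i | f i ∈ N} : Finset (Fin m)), crossingEdges H τ f) = t} ≠ 0 := by
    have h := lt_of_lt_of_le (by positivity) ht
    exact_mod_cast h.ne'
  obtain ⟨f, hf⟩ := card_ne_zero.1 hne
  rw [mem_filter, hZdef, mem_filter] at hf
  obtain ⟨⟨-, -, hfs⟩, rfl⟩ := hf
  refine hρ (({i | f i ∈ N} : Finset (Fin m)), crossingEdges H τ f)
      (fun x hx => (mem_filter.1 hx).2.1) ?_ V P
    ((le_sup (mem_univ _)).trans ((le_max_right _ _).trans hP)) H N τ hτ hN _ ht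
    fun g hg => ?_
  · rintro ⟨w, hw0, hwR, hwX, hw⟩
    exact false_of_concentrated hξ hη hξγ hη' hξ' hm hmγ hA hB hdeg hAc hBc hNc hfs hw0 hwR hwX hw
  · rw [mem_filter, hZdef, mem_filter] at hg
    exact ⟨hg.1.2.1, congrArg Prod.fst hg.2, congrArg Prod.snd hg.2⟩

/-- The ordered pairs completing `z` to an edge. -/
def link {V : Type} [DecidableEq V] [Fintype V] (H : Finset (Finset V)) (z : V) : Finset (V × V) :=
  {x | {z, x.1, x.2} ∈ H}

lemma two_mul_deg_le_card_link {n : ℕ} {H : Finset (Finset (Fin n))} (hH : Is3Graph n H)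
    (z : Fin n) : 2 * deg H z ≤ #(link H z) := by
  let s : Finset (Fin n × Fin n) := {x ∈ link H z | z ∈ ({z, x.1, x.2} : Finset (Fin n))}
  have h : 2 * deg H z ≤ #s := by
    rw [deg]
    rw [card_eq_sum_card_fiberwise (s := s) (f := fun x => ({z, x.1, x.2} : Finset (Fin n)))
      (t := H.filter fun e => z ∈ e)
      (fun x hx => by
        rw [mem_coe, mem_filter, link, mem_filter] at hx
        rw [mem_coe, mem_filter]
        exact ⟨hx.1.2, hx.2⟩), mul_comm, ← smul_eq_mul]
    refine card_nsmul_le_sum _ _ _ fun e he => ?_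
    rw [mem_filter] at he
    have hc := hH e he.1
    rw [← insert_erase he.2, card_insert_of_notMem (by simp)] at hc
    obtain ⟨x, y, hxy, he'⟩ := card_eq_two.1 (show #(e.erase z) = 2 by omega)
    have hez : ({z, x, y} : Finset (Fin n)) = e := by rw [← insert_erase he.2, he']
    have hez' : ({z, y, x} : Finset (Fin n)) = e := by rw [← hez, pair_comm]
    have hsub : ({(x, y), (y, x)} : Finset (Fin n × Fin n)) ⊆
        {a ∈ s | ({z, a.1, a.2} : Finset (Fin n)) = e} := by
      intro a ha
      rw [mem_insert, mem_singleton] at ha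
      rcases ha with rfl | rfl <;> simp [s, link, hez, hez', he.1]
    refine (card_pair ?_).ge.trans (card_le_card hsub)
    simp [hxy]
  exact h.trans (card_filter_le _ _)

lemma card_link_le_sum_linkCount {V P : Type} [DecidableEq V] [Fintype V] [Fintype P]
    (H : Finset (Finset V))
    {τ : P → Fin 3 → V} (hτ : ∀ p a q b, τ p a = τ q b → p = q ∧ a = b) (z : V) :
    (#(link H z) : ℝ) ≤ ∑ p, ∑ q, linkCount H τ z p q +
      2 * ((Fintype.card V : ℝ) - 3 * Fintype.card P) * Fintype.card V := by
  let T : Finset V := univ.image fun x : P × Fin 3 => τ x.1 x.2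
  have hinj : Function.Injective fun x : P × Fin 3 => τ x.1 x.2 := fun x y h =>
    Prod.ext (hτ _ _ _ _ h).1 (hτ _ _ _ _ h).2
  have hT : #T = 3 * Fintype.card P := by
    rw [card_image_of_injective _ hinj, card_univ, Fintype.card_prod, Fintype.card_fin, mul_comm]
  have hTc : (#Tᶜ : ℝ) = Fintype.card V - 3 * Fintype.card P := by
    rw [card_compl, Nat.cast_sub (card_le_univ _), hT]
    push_cast
    ring
  have hsum : ∀ F : V → ℝ, ∑ p, ∑ a, F (τ p a) = ∑ x ∈ T, F x := by
    intro F
    rw [sum_image fun x _ y _ h => hinj h, Fintype.sum_prod_type]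
  have h1 : ∑ p, ∑ q, linkCount H τ z p q =
      #((T ×ˢ T).filter fun x => {z, x.1, x.2} ∈ H) := by
    rw [← sum_boole, sum_product]
    rw [← hsum fun x => ∑ y ∈ T, if {z, x, y} ∈ H then (1 : ℝ) else 0]
    refine sum_congr rfl fun p _ => ?_
    simp only [linkCount]
    rw [sum_comm]
    refine sum_congr rfl fun a _ => ?_
    rw [← hsum fun y => if {z, τ p a, y} ∈ H then (1 : ℝ) else 0]
  have h2 : link H z ⊆ ((T ×ˢ T).filter fun x => {z, x.1, x.2} ∈ H) ∪
      (Tᶜ ×ˢ univ ∪ univ ×ˢ Tᶜ) := by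
    intro x hx
    have hx := (mem_filter.1 hx).2
    simp only [mem_union, mem_filter, mem_product, mem_compl, mem_univ, and_true, true_and]
    tauto
  have h3 := (card_le_card h2).trans ((card_union_le _ _).trans
    (Nat.add_le_add_left (card_union_le _ _) _))
  rw [card_product, card_product, card_univ] at h3
  have h4 : (#(link H z) : ℝ) ≤ #((T ×ˢ T).filter fun x => {z, x.1, x.2} ∈ H) +
      (#Tᶜ * Fintype.card V + Fintype.card V * #Tᶜ) := by exact_mod_cast h3
  rw [h1, ← hTc]
  linarith

lemma sum_missCount_le {V P : Type} [DecidableEq V] [Fintype V] [Fintype P] (A : Finset V)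
    {τ : P → Fin 3 → V} (hτ : ∀ p a q b, τ p a = τ q b → p = q ∧ a = b) :
    ∑ p, missCount A (τ p) ≤ #Aᶜ := by
  have h : ∑ p, missCount A (τ p) = ∑ x : P × Fin 3, if τ x.1 x.2 ∉ A then (1 : ℝ) else 0 := by
    rw [Fintype.sum_prod_type]
    refine sum_congr rfl fun p _ => sum_congr rfl fun a _ => ?_
    by_cases h : τ p a ∈ A <;> simp [h]
  rw [h, sum_boole]
  have : #{x : P × Fin 3 | τ x.1 x.2 ∉ A} ≤ #Aᶜ := by
    refine card_le_card_of_injOn (fun x => τ x.1 x.2) (fun x hx => ?_) fun x _ y _ h => ?_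
    · simpa using hx
    · exact Prod.ext (hτ _ _ _ _ h).1 (hτ _ _ _ _ h).2
  exact_mod_cast this

lemma le_meanLink {n : ℕ} {H : Finset (Finset (Fin n))} (hH : Is3Graph n H) {P : Type} [Fintype P]
    {τ : P → Fin 3 → Fin n} (hτ : ∀ p a q b, τ p a = τ q b → p = q ∧ a = b)
    {γ η : ℝ} (hηγ : 9 * η ≤ γ) (hγ : γ ≤ 1) (hn : 2 ≤ η * n) (hn0 : 0 < n)
    (hr : (n : ℝ) - 3 * Fintype.card P ≤ 2 * η * n) (hP : 0 < Fintype.card P) {z : Fin n} {c : ℝ}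
    (hc0 : 0 ≤ c) (hc : c ≤ 9)
    (hdeg : (c / 9 + γ) * (n.choose 2) ≤ (deg H z : ℝ)) : c + 3 * γ ≤ meanLink H τ z := by
  have h1 := card_link_le_sum_linkCount H hτ z
  have h2 : (2 * deg H z : ℝ) ≤ #(link H z) := by exact_mod_cast two_mul_deg_le_card_link hH z
  have hn' : (0 : ℝ) < n := by exact_mod_cast hn0
  have hη : 0 < η := by
    by_contra! h
    nlinarith
  have hP' : (0 : ℝ) < Fintype.card P := by exact_mod_cast hP
  have h3 : 3 * (Fintype.card P : ℝ) ≤ n := by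
    have : Fintype.card (P × Fin 3) ≤ Fintype.card (Fin n) :=
      Fintype.card_le_of_injective (fun x => τ x.1 x.2) fun x y h =>
        Prod.ext (hτ _ _ _ _ h).1 (hτ _ _ _ _ h).2
    rw [Fintype.card_prod, Fintype.card_fin, Fintype.card_fin] at this
    have : ((Fintype.card P * 3 : ℕ) : ℝ) ≤ n := by exact_mod_cast this
    push_cast at this
    linarith
  rw [Fintype.card_fin] at h1
  rw [Nat.cast_choose_two] at hdeg
  rw [meanLink, le_div_iff₀ (by positivity)]
  have h4 : (n : ℝ) ≤ η / 2 * n ^ 2 := by nlinarith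
  have h5 : (c / 9 + γ) * n ≤ 2 * (η / 2 * n ^ 2) := by
    have : (c / 9 + γ) * n ≤ 2 * n := mul_le_mul_of_nonneg_right (by linarith) hn'.le
    linarith
  have h6 : 2 * ((n : ℝ) - 3 * Fintype.card P) * n ≤ 4 * η * n ^ 2 := by nlinarith
  have h7 : (c / 9 + γ - 5 * η) * (n : ℝ) ^ 2 ≤ ∑ p, ∑ q, linkCount H τ z p q := by
    nlinarith
  refine le_trans ?_ h7
  have h8 : 9 * (Fintype.card P : ℝ) ^ 2 ≤ n ^ 2 := by nlinarith
  have h9 : (c + 3 * γ) ≤ 9 * (c / 9 + γ - 5 * η) := by linarith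
  calc (c + 3 * γ) * (Fintype.card P : ℝ) ^ 2
      ≤ 9 * (c / 9 + γ - 5 * η) * (Fintype.card P : ℝ) ^ 2 :=
        mul_le_mul_of_nonneg_right h9 (by positivity)
    _ = (c / 9 + γ - 5 * η) * (9 * (Fintype.card P : ℝ) ^ 2) := by ring
    _ ≤ _ := mul_le_mul_of_nonneg_left h8 (by linarith)

/-- The degree conditions of the main theorem, for vertex sets `A` and `B` of large degree. -/
def DegreeCondition (γ : ℝ) {n : ℕ} (H : Finset (Finset (Fin n))) (A B : Finset (Fin n)) : Prop :=
  (∀ v ∈ A, (5 / 9 + γ) * (n.choose 2) ≤ (deg H v : ℝ)) ∧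
  (∀ v ∈ B, (4 / 9 + γ) * (n.choose 2) ≤ (deg H v : ℝ)) ∧
  (∀ v, (3 / 9 + γ) * (n.choose 2) ≤ (deg H v : ℝ)) ∧
  3 * (#Aᶜ : ℝ) ≤ n ∧ (#Bᶜ : ℝ) ≤ 0.18351 * n

/-- Outside a small set `D`, all but few vertices can be covered by a matching. -/
lemma exists_almost_perfect_matching {γ η ε : ℝ} (hγ : γ ≤ 1) (hη : 0 < η) (hηγ : 16 * η ≤ γ)
    (hη' : η ≤ 1 / 10000) (hε : 0 < ε) :
    ∃ n₀ : ℕ, ∀ n ≥ n₀, ∀ H : Finset (Finset (Fin n)), Is3Graph n H →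
      ∀ A B D : Finset (Fin n), DegreeCondition γ H A B → (#D : ℝ) ≤ η * n →
      ∃ M ⊆ H, Disjoint (cover M) D ∧ #(cover M) = 3 * #M ∧
        (#(cover M ∪ D)ᶜ : ℝ) ≤ ε * n := by
  obtain ⟨ξ, hξ, hξε, hξγ, hξ'⟩ : ∃ ξ : ℝ, 0 < ξ ∧ 6 * ξ ≤ ε ∧ 8 * ξ ≤ γ ∧ ξ ≤ 1 / 50000 :=
    ⟨min (ε / 6) (min (γ / 8) (1 / 50000)), by
      refine lt_min (by positivity) (lt_min ?_ (by norm_num)); linarith, by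
      have := min_le_left (ε / 6) (min (γ / 8) (1 / 50000)); linarith, by
      have := (min_le_right (ε / 6) (min (γ / 8) (1 / 50000))).trans (min_le_left _ _); linarith,
      (min_le_right _ _).trans (min_le_right _ _)⟩
  obtain ⟨r₀, hr₀⟩ := exists_larger_of_meanLink (γ := γ) (ξ := ξ) (η := 4 * η) hξ (by positivity)
    (by linarith) (by linarith) hξ'
  obtain ⟨n₁, hn₁⟩ := exists_nat_gt (2 / η)
  obtain ⟨n₂, hn₂⟩ := exists_nat_gt (4 / ε)
  refine ⟨max (max n₁ n₂) (4 * r₀ + 4), fun n hn H hH A B D hAB hD => ?_⟩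
  have hnn₁ : (n₁ : ℝ) ≤ n := by
    exact_mod_cast (le_max_left n₁ n₂).trans ((le_max_left _ _).trans hn)
  have hnn₂ : (n₂ : ℝ) ≤ n := by
    exact_mod_cast (le_max_right n₁ n₂).trans ((le_max_left _ _).trans hn)
  have hnr : 4 * r₀ + 4 ≤ n := (le_max_right _ _).trans hn
  have hnr' : 4 * (r₀ : ℝ) + 4 ≤ n := by exact_mod_cast hnr
  have hηn : 2 ≤ η * n := by rw [div_lt_iff₀ hη] at hn₁; nlinarith
  have hεn : 4 ≤ ε * n := by rw [div_lt_iff₀ hε] at hn₂; nlinarith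
  let Q : ℕ → Prop := fun N => ∃ g : Fin N → Fin 3 → Fin n,
    (∀ p a q b, g p a = g q b → p = q ∧ a = b) ∧ (∀ j, univ.image (g j) ∈ H) ∧ ∀ j a, g j a ∉ D
  have hQn : ∀ N, Q N → N ≤ n := by
    rintro N ⟨g, hg, -⟩
    simpa using Fintype.card_le_of_injective (fun j => g j 0) fun j k h => (hg _ _ _ _ h).1
  have hQ0 : Q 0 := ⟨fun j => j.elim0, fun p => p.elim0, fun p => p.elim0, fun p => p.elim0⟩
  obtain ⟨N, hN, hmax⟩ : ∃ N, Q N ∧ ∀ N', Q N' → N' ≤ N :=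
    ⟨Nat.findGreatest Q n, Nat.findGreatest_spec (Nat.zero_le _) hQ0, fun N hN =>
      Nat.le_findGreatest (hQn N hN) hN⟩
  obtain ⟨g, hginj, hgH, hgD⟩ := hN
  let G : Finset (Fin n) := univ.image fun x : Fin N × Fin 3 => g x.1 x.2
  have hginj' : Function.Injective fun x : Fin N × Fin 3 => g x.1 x.2 := fun x y h =>
    Prod.ext (hginj _ _ _ _ h).1 (hginj _ _ _ _ h).2
  have hG : #G = 3 * N := by
    rw [card_image_of_injective _ hginj', card_univ, Fintype.card_prod, Fintype.card_fin,
      Fintype.card_fin, mul_comm]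
  let M : Finset (Finset (Fin n)) := univ.image fun j => univ.image (g j)
  have hMG : cover M = G := by
    ext v
    simp only [cover, M, G, mem_biUnion, mem_image, mem_univ, true_and, exists_exists_eq_and, id,
      Prod.exists]
  have hM : #M = N := by
    rw [card_image_of_injective, card_univ, Fintype.card_fin]
    intro j k h
    have : g j 0 ∈ univ.image (g k) := by
      have h' : univ.image (g j) = univ.image (g k) := h
      rw [← h']
      exact mem_image_of_mem _ (mem_univ _)
    obtain ⟨b, -, hb⟩ := mem_image.1 this
    exact (hginj _ _ _ _ hb.symm).1
  have hGD : Disjoint G D := by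
    rw [disjoint_left]
    intro v hv
    obtain ⟨x, -, rfl⟩ := mem_image.1 hv
    exact hgD _ _
  refine ⟨M, ?_, hMG ▸ hGD, by rw [hMG, hG, hM], ?_⟩
  · intro e he
    obtain ⟨j, -, rfl⟩ := mem_image.1 he
    exact hgH j
  rw [hMG]
  by_contra! hlarge
  obtain ⟨W, hW⟩ : ∃ W, W = (G ∪ D)ᶜ := ⟨_, rfl⟩
  rw [← hW] at hlarge
  have hWc : #W + 3 * N + #D = n := by
    have h1 : #(G ∪ D) + #(G ∪ D)ᶜ = Fintype.card (Fin n) := card_add_card_compl _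
    rw [← hW, card_union_of_disjoint hGD, hG, Fintype.card_fin] at h1
    omega
  let L := #W / 3
  obtain ⟨h⟩ : Nonempty (Fin L × Fin 3 ↪ W) := Function.Embedding.nonempty_of_card_le (by
    simp only [Fintype.card_prod, Fintype.card_fin, Fintype.card_coe, L]; omega)
  let τ : Fin N ⊕ Fin L → Fin 3 → Fin n := Sum.elim g fun l a => h (l, a)
  have hhW : ∀ x, (h x : Fin n) ∉ G ∧ (h x : Fin n) ∉ D := fun x => by
    have : ∀ w ∈ W, w ∉ G ∧ w ∉ D := fun w hw => by
      rwa [hW, mem_compl, mem_union, not_or] at hw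
    exact this _ (h x).2
  have hgG : ∀ j a, g j a ∈ G := fun j a => mem_image.2 ⟨(j, a), mem_univ _, rfl⟩
  have hτ : ∀ p a q b, τ p a = τ q b → p = q ∧ a = b := by
    rintro (j | l) a (k | l') b hh
    · have := hginj _ _ _ _ hh
      exact ⟨congrArg _ this.1, this.2⟩
    · exact absurd ((show g j a = h (l', b) from hh) ▸ hgG j a) (hhW _).1
    · exact absurd ((show (h (l, a) : Fin n) = g k b from hh).symm ▸ hgG k b) (hhW _).1
    · have := h.injective (Subtype.ext (show (h (l, a) : Fin n) = h (l', b) from hh))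
      rw [Prod.mk.injEq] at this
      exact ⟨congrArg _ this.1, this.2⟩
  have hr : Fintype.card (Fin N ⊕ Fin L) = N + L := by simp
  have hrn : n ≤ 3 * (N + L) + #D + 2 := by simp only [L]; omega
  have hrn' : (n : ℝ) ≤ 3 * ((N + L : ℕ) : ℝ) + #D + 2 := by exact_mod_cast hrn
  have hrn2 : 3 * ((N + L : ℕ) : ℝ) ≤ n := by
    have : 3 * (N + L) ≤ n := by simp only [L]; omega
    exact_mod_cast this
  have hr2 : (n : ℝ) - 3 * ((N + L : ℕ) : ℝ) ≤ 2 * η * n := by linarith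
  have hrpos : r₀ + 1 ≤ N + L := by
    have h1 : (n : ℝ) - 3 * ((N + L : ℕ) : ℝ) ≤ 1 / 5000 * n := by
      refine hr2.trans (mul_le_mul_of_nonneg_right (by linarith) (Nat.cast_nonneg _))
    have : ((r₀ + 1 : ℕ) : ℝ) ≤ ((N + L : ℕ) : ℝ) := by push_cast at *; linarith
    exact_mod_cast this
  obtain ⟨hA, hB, hall, hAc, hBc⟩ := hAB
  have hmean : ∀ (z : Fin n) (c : ℝ), 0 ≤ c → c ≤ 9 →
      (c / 9 + γ) * (n.choose 2) ≤ (deg H z : ℝ) → c + 3 * γ ≤ meanLink H τ z :=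
    fun z c hc0 hc hd => le_meanLink hH hτ (η := η) (by linarith) hγ hηn (by omega)
      (by rw [hr]; exact hr2) (by rw [hr]; omega) hc0 hc hd
  have hsA : ∑ p, missCount A (τ p) ≤ (1 + 4 * η) * Fintype.card (Fin N ⊕ Fin L) := by
    refine (sum_missCount_le A hτ).trans ?_
    rw [hr]
    nlinarith
  have hsB : ∑ p, missCount B (τ p) ≤ 0.5509 * Fintype.card (Fin N ⊕ Fin L) := by
    refine (sum_missCount_le B hτ).trans ?_
    rw [hr]
    have : η * n ≤ 1 / 10000 * n := mul_le_mul_of_nonneg_right hη' (Nat.cast_nonneg _)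
    linarith
  have hsN : 3 * ξ * Fintype.card (Fin N ⊕ Fin L) ≤
      (∑ p : Fin N ⊕ Fin L, if p ∈ univ.image Sum.inl then 0 else 1 : ℝ) := by
    rw [hr, Fintype.sum_sum_type]
    have h1 : ∑ l : Fin L, (if (Sum.inr l : Fin N ⊕ Fin L) ∈ univ.image Sum.inl then (0 : ℝ)
        else 1) = L := by simp
    have h2 : 0 ≤ ∑ l : Fin N, (if (Sum.inl l : Fin N ⊕ Fin L) ∈ univ.image Sum.inl then (0 : ℝ)
        else 1) := sum_nonneg fun _ _ => by split_ifs <;> norm_num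
    rw [h1]
    have h3 : (#W : ℝ) ≤ 3 * L + 2 := by
      have : #W ≤ 3 * L + 2 := by simp only [L]; omega
      exact_mod_cast this
    have h4 : 3 * ξ * ((N + L : ℕ) : ℝ) ≤ ξ * n := by nlinarith
    have h5 : 6 * ξ * n ≤ ε * n := mul_le_mul_of_nonneg_right hξε (Nat.cast_nonneg _)
    linarith
  obtain ⟨J, hJ, g', hg'inj, hg'H, hcard, hg'⟩ := hr₀ (Fin n) (Fin N ⊕ Fin L)
    (by rw [hr]; omega) H (univ.image Sum.inl) τ A B hτ
    (fun p hp => by obtain ⟨j, -, rfl⟩ := mem_image.1 hp; exact hgH j)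
    (fun p a hp => hmean _ 5 (by norm_num) (by norm_num) (hA _ hp))
    (fun p a hp => hmean _ 4 (by norm_num) (by norm_num) (hB _ hp))
    (fun p a => hmean _ 3 (by norm_num) (by norm_num) (hall _)) hsA hsB
    (by convert hsN)
  · rw [card_image_of_injective _ Sum.inl_injective, card_univ, Fintype.card_fin] at hcard
    refine absurd (hmax (Fintype.card J) ?_) (not_le.2 hcard)
    let e := Fintype.equivFin J
    refine ⟨fun j => g' (e.symm j), fun p a q b hpq => ?_, fun j => hg'H _, fun j a => ?_⟩
    · have := hg'inj _ _ _ _ hpq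
      exact ⟨e.symm.injective this.1, this.2⟩
    · obtain ⟨p, b, hpb⟩ := hg' (e.symm j) a
      show g' (e.symm j) a ∉ D
      rw [hpb]
      rcases p with p | p
      · exact hgD _ _
      · exact (hhW _).2

/-- Greedy choice of pairwise disjoint gadgets, controlled by an exponential potential. -/
lemma exists_disjoint_gadgets {X V ι : Type} [DecidableEq X] [DecidableEq V] [Fintype ι]
    [Nonempty ι]
    (supp : X → Finset V) (𝒳 : Finset X) (𝒜 : ι → Finset X) {δ D N : ℝ} (hδ : 0 < δ)
    (hD : 0 ≤ D) (hN : 0 < N) (h𝒜 : ∀ i, 𝒜 i ⊆ 𝒳) (hsupp : ∀ x ∈ 𝒳, #(supp x) ≤ 6)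
    (hdeg : ∀ v, (#{x ∈ 𝒳 | v ∈ supp x} : ℝ) ≤ D) (hcard : ∀ i, δ * N ≤ #(𝒜 i))
    (h𝒳 : (#𝒳 : ℝ) ≤ N) (k : ℕ) (hk : 12 * k * D ≤ δ * N) :
    ∃ F : Fin k → X, (∀ j, F j ∈ 𝒳) ∧ (∀ i j, i ≠ j → Disjoint (supp (F i)) (supp (F j))) ∧
      ∑ i, ∏ j, (if F j ∈ 𝒜 i then 1 / 2 else 1 : ℝ) ≤ Fintype.card ι * (1 - δ / 4) ^ k := by
  have hδ1 : δ ≤ 1 := by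
    obtain ⟨i⟩ := ‹Nonempty ι›
    have : (#(𝒜 i) : ℝ) ≤ #𝒳 := by exact_mod_cast card_le_card (h𝒜 i)
    have := hcard i
    nlinarith
  induction k with
  | zero => exact ⟨fun j => j.elim0, fun j => j.elim0, fun j => j.elim0, by simp⟩
  | succ k ih =>
    push_cast at hk
    obtain ⟨F, hF, hFd, hΦ⟩ := ih (by nlinarith)
    let U := univ.biUnion fun j => supp (F j)
    have hU : (#U : ℝ) ≤ 6 * k := by
      have : #U ≤ #(univ : Finset (Fin k)) * 6 := card_biUnion_le_card_mul _ _ _ fun j _ =>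
        hsupp _ (hF j)
      rw [card_univ, Fintype.card_fin] at this
      have : (#U : ℝ) ≤ k * 6 := by exact_mod_cast this
      linarith
    let Y := {x ∈ 𝒳 | Disjoint (supp x) U}
    have hYN : (#Y : ℝ) ≤ N := le_trans (by exact_mod_cast card_filter_le _ _) h𝒳
    have hbad : (#{x ∈ 𝒳 | ¬ Disjoint (supp x) U} : ℝ) ≤ 6 * k * D := by
      have h1 : {x ∈ 𝒳 | ¬ Disjoint (supp x) U} ⊆ U.biUnion fun v => {x ∈ 𝒳 | v ∈ supp x} := by
        intro x hx
        rw [mem_filter, not_disjoint_iff] at hx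
        obtain ⟨v, hv, hvU⟩ := hx.2
        exact mem_biUnion.2 ⟨v, hvU, mem_filter.2 ⟨hx.1, hv⟩⟩
      have h2 : (#{x ∈ 𝒳 | ¬ Disjoint (supp x) U} : ℝ) ≤
          ∑ v ∈ U, (#{x ∈ 𝒳 | v ∈ supp x} : ℝ) := by
        exact_mod_cast (card_le_card h1).trans card_biUnion_le
      refine h2.trans ((sum_le_card_nsmul _ _ D fun v _ => hdeg v).trans ?_)
      rw [nsmul_eq_mul]
      exact mul_le_mul_of_nonneg_right hU hD
    have hgood : ∀ i, δ * N / 2 ≤ #{x ∈ Y | x ∈ 𝒜 i} := by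
      intro i
      have h1 : 𝒜 i ⊆ {x ∈ Y | x ∈ 𝒜 i} ∪ {x ∈ 𝒳 | ¬ Disjoint (supp x) U} := by
        intro x hx
        have := h𝒜 i hx
        by_cases h : Disjoint (supp x) U
        · exact mem_union_left _ (mem_filter.2 ⟨mem_filter.2 ⟨this, h⟩, hx⟩)
        · exact mem_union_right _ (mem_filter.2 ⟨this, h⟩)
      have h2 : (#(𝒜 i) : ℝ) ≤ #{x ∈ Y | x ∈ 𝒜 i} + #{x ∈ 𝒳 | ¬ Disjoint (supp x) U} := by
        exact_mod_cast (card_le_card h1).trans (card_union_le _ _)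
      have := hcard i
      linarith
    have hYne : Y.Nonempty := by
      obtain ⟨i⟩ := ‹Nonempty ι›
      have h1 : (0 : ℝ) < #{x ∈ Y | x ∈ 𝒜 i} := lt_of_lt_of_le (by positivity) (hgood i)
      obtain ⟨x, hx⟩ := card_pos.1 (Nat.cast_pos.1 h1)
      exact ⟨x, (mem_filter.1 hx).1⟩
    let w : ι → ℝ := fun i => ∏ j, (if F j ∈ 𝒜 i then 1 / 2 else 1 : ℝ)
    have hw : ∀ i, 0 ≤ w i := fun i => prod_nonneg fun j _ => by split_ifs <;> norm_num
    have hsum : ∑ x ∈ Y, ∑ i, (if x ∈ 𝒜 i then 1 / 2 else 1 : ℝ) * w i ≤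
        ∑ x ∈ Y, (1 - δ / 4) * ∑ i, w i := by
      rw [sum_comm, sum_const, nsmul_eq_mul, mul_sum, mul_sum]
      refine sum_le_sum fun i _ => ?_
      rw [← sum_mul]
      have h1 : ∑ x ∈ Y, (if x ∈ 𝒜 i then 1 / 2 else 1 : ℝ) =
          #Y - 1 / 2 * #{x ∈ Y | x ∈ 𝒜 i} := by
        rw [← sum_boole (fun x => x ∈ 𝒜 i) Y, mul_sum, card_eq_sum_ones, Nat.cast_sum,
          ← sum_sub_distrib]
        refine sum_congr rfl fun x _ => ?_
        split_ifs <;> norm_num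
      rw [h1, ← mul_assoc]
      refine mul_le_mul_of_nonneg_right ?_ (hw i)
      have := hgood i
      nlinarith
    obtain ⟨x, hx, hxle⟩ := exists_le_of_sum_le hYne hsum
    have hxY := mem_filter.1 hx
    have hxd : ∀ j, Disjoint (supp x) (supp (F j)) := fun j =>
      hxY.2.mono_right (subset_biUnion_of_mem (fun j => supp (F j)) (mem_univ j))
    refine ⟨Fin.cons x F, ?_, ?_, ?_⟩
    · intro j
      refine Fin.cases ?_ (fun j => ?_) j
      · simpa using hxY.1
      · simpa using hF j
    · intro i j
      refine Fin.cases ?_ (fun i => ?_) i <;> refine Fin.cases ?_ (fun j => ?_) j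
      · simp
      · intro _
        simpa using hxd j
      · intro _
        simpa using (hxd i).symm
      · intro hij
        simpa using hFd i j fun h => hij (by rw [h])
    · simp only [Fin.prod_univ_succ, Fin.cons_zero, Fin.cons_succ]
      refine hxle.trans ?_
      rw [pow_succ]
      calc (1 - δ / 4) * ∑ i, w i ≤ (1 - δ / 4) * (Fintype.card ι * (1 - δ / 4) ^ k) :=
            mul_le_mul_of_nonneg_left hΦ (by linarith)
        _ = _ := by ring

/-- The vertices of an absorbing gadget. -/
def gadgetSupport {V : Type} [DecidableEq V] (x : (V × V) × (V × V) × V × V) : Finset V :=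
  {x.1.1, x.1.2, x.2.1.1, x.2.1.2, x.2.2.1, x.2.2.2}

/-- The gadget `x` has six vertices, spanned by two disjoint edges. -/
def IsGadget {V : Type} [DecidableEq V] (H : Finset (Finset V))
    (x : (V × V) × (V × V) × V × V) : Prop :=
  #(gadgetSupport x) = 6 ∧ {x.1.1, x.2.1.1, x.2.1.2} ∈ H ∧ {x.1.2, x.2.2.1, x.2.2.2} ∈ H

/-- The gadget `x` can absorb the triple `v`. -/
def CanAbsorb {V : Type} [DecidableEq V] (H : Finset (Finset V))
    (x : (V × V) × (V × V) × V × V) (v : V × V × V) : Prop :=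
  {v.1, x.1.1, x.1.2} ∈ H ∧ {v.2.1, x.2.1.1, x.2.1.2} ∈ H ∧ {v.2.2, x.2.2.1, x.2.2.2} ∈ H

lemma card_gadgets_containing_le {n : ℕ}
    (𝒳 : Finset ((Fin n × Fin n) × (Fin n × Fin n) × Fin n × Fin n))
    (v : Fin n) : (#{x ∈ 𝒳 | v ∈ gadgetSupport x} : ℝ) ≤ 6 * (n : ℝ) ^ 5 := by
  let U : Finset (Fin n) := univ
  have h : {x ∈ 𝒳 | v ∈ gadgetSupport x} ⊆
      ((({v} ×ˢ U) ×ˢ univ) ∪ ((U ×ˢ {v}) ×ˢ univ)) ∪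
      (((univ : Finset (Fin n × Fin n)) ×ˢ (({v} ×ˢ U) ×ˢ univ)) ∪
        ((univ : Finset (Fin n × Fin n)) ×ˢ ((U ×ˢ {v}) ×ˢ univ))) ∪
      (((univ : Finset (Fin n × Fin n)) ×ˢ ((univ : Finset (Fin n × Fin n)) ×ˢ ({v} ×ˢ U))) ∪
        ((univ : Finset (Fin n × Fin n)) ×ˢ ((univ : Finset (Fin n × Fin n)) ×ˢ (U ×ˢ {v})))) := by
    intro x hx
    rw [mem_filter, gadgetSupport] at hx
    have := hx.2
    simp only [mem_insert, mem_singleton] at this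
    simp only [mem_union, mem_product, mem_singleton, mem_univ, U, and_true, true_and]
    tauto
  have h' : #{x ∈ 𝒳 | v ∈ gadgetSupport x} ≤ 6 * n ^ 5 := by
    refine (card_le_card h).trans ((card_union_le _ _).trans ((add_le_add ((card_union_le _ _).trans
      (add_le_add (card_union_le _ _) (card_union_le _ _))) (card_union_le _ _)).trans
          (le_of_eq ?_)))
    simp only [card_product, card_singleton, card_univ, Fintype.card_prod, Fintype.card_fin, U]
    ring
  exact_mod_cast h'

lemma card_le_card_filter_avoid {n : ℕ} (S : Finset (Fin n × Fin n)) (R : Finset (Fin n)) :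
    (#S : ℝ) - 2 * #R * n ≤ #{x ∈ S | x.1 ∉ R ∧ x.2 ∉ R} := by
  have h : S ⊆ {x ∈ S | x.1 ∉ R ∧ x.2 ∉ R} ∪ (R ×ˢ univ ∪ univ ×ˢ R) := by
    intro x hx
    simp only [mem_union, mem_filter, mem_product, mem_univ, and_true, true_and]
    tauto
  have h' := (card_le_card h).trans ((card_union_le _ _).trans
    (Nat.add_le_add_left (card_union_le _ _) _))
  simp only [card_product, card_univ, Fintype.card_fin] at h'
  have : (#S : ℝ) ≤ #{x ∈ S | x.1 ∉ R ∧ x.2 ∉ R} + (#R * n + n * #R) := by exact_mod_cast h'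
  linarith

lemma mul_le_card_filter_product {α β : Type} [DecidableEq α] [Fintype α] [Fintype β]
    (S : Finset α) (P : α → β → Prop) [∀ a b, Decidable (P a b)] {c : ℝ}
    (h : ∀ a ∈ S, c ≤ #{b | P a b}) :
    #S * c ≤ (#{x : α × β | x.1 ∈ S ∧ P x.1 x.2} : ℝ) := by
  have h1 : (#{x : α × β | x.1 ∈ S ∧ P x.1 x.2} : ℝ) = ∑ a ∈ S, (#{b | P a b} : ℝ) := by
    rw [← sum_boole, Fintype.sum_prod_type, ← sum_filter_add_sum_filter_not univ (· ∈ S)]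
    rw [sum_eq_zero (s := {x | x ∉ S}), add_zero]
    · rw [filter_mem_eq_inter, univ_inter]
      refine sum_congr rfl fun a ha => ?_
      rw [← sum_boole]
      simp [ha]
    · intro a ha
      simp [(mem_filter.1 ha).2]
  rw [h1, ← nsmul_eq_mul]
  exact card_nsmul_le_sum _ _ _ h

lemma le_card_link {n : ℕ} {H : Finset (Finset (Fin n))} (hH : Is3Graph n H) {z : Fin n} {c : ℝ}
    (hc : c ≤ 2) (hz : c * (n.choose 2) ≤ (deg H z : ℝ)) :
    c * (n : ℝ) ^ 2 - 2 * n ≤ #(link H z) := by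
  have h : (2 * deg H z : ℝ) ≤ #(link H z) := by exact_mod_cast two_mul_deg_le_card_link hH z
  rw [Nat.cast_choose_two] at hz
  have : c * n ≤ 2 * n := mul_le_mul_of_nonneg_right hc (Nat.cast_nonneg _)
  linarith

lemma card_add_card_le_card_inter_add {n : ℕ} (S T : Finset (Fin n × Fin n)) :
    (#S : ℝ) + #T ≤ #(S ∩ T) + (n : ℝ) ^ 2 := by
  have h1 : #(S ∪ T) ≤ n ^ 2 := by
    refine (card_le_univ _).trans (le_of_eq ?_)
    rw [Fintype.card_prod, Fintype.card_fin, sq]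
  have h2 : #(S ∪ T) + #(S ∩ T) = #S + #T := card_union_add_card_inter _ _
  have h3 : #S + #T ≤ #(S ∩ T) + n ^ 2 := by omega
  exact_mod_cast h3

lemma ne_of_mem_link {n : ℕ} {H : Finset (Finset (Fin n))} (hH : Is3Graph n H) {z x y : Fin n}
    (h : ({z, x, y} : Finset (Fin n)) ∈ H) : x ≠ y := by
  rintro rfl
  have h1 := hH _ h
  have : #({z, x, x} : Finset (Fin n)) ≤ 2 := by
    rw [pair_eq_singleton]
    exact card_le_two
  omega

lemma card_gadgetSupport {V : Type} [DecidableEq V] {a b c d e f : V} (hab : a ≠ b) (hcd : c ≠ d)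
    (hef : e ≠ f) (hca : c ≠ a) (hcb : c ≠ b) (hda : d ≠ a) (hdb : d ≠ b) (hea : e ≠ a)
    (heb : e ≠ b) (hec : e ≠ c) (hed : e ≠ d) (hfa : f ≠ a) (hfb : f ≠ b) (hfc : f ≠ c)
    (hfd : f ≠ d) : #(gadgetSupport ((a, b), (c, d), e, f)) = 6 := by
  simp only [gadgetSupport]
  rw [card_insert_of_notMem (by simp [hab, hca.symm, hda.symm, hea.symm, hfa.symm]),
    card_insert_of_notMem (by simp [hcb.symm, hdb.symm, heb.symm, hfb.symm]),
    card_insert_of_notMem (by simp [hcd, hec.symm, hfc.symm]),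
    card_insert_of_notMem (by simp [hed.symm, hfd.symm]), card_pair hef]

/-- The number of gadgets absorbing a given triple. -/
lemma le_card_absorbers {n : ℕ} {γ : ℝ} {H : Finset (Finset (Fin n))} (hH : Is3Graph n H)
    (hγ0 : 0 < γ) (hγ : γ ≤ 1) (hn : 16 ≤ γ * n) {A B : Finset (Fin n)}
    (hAB : DegreeCondition γ H A B) (hB : 2 / 3 * (n : ℝ) ^ 2 ≤ (#B : ℝ) ^ 2)
    (v : Fin n × Fin n × Fin n) (hv : v.2.1 ∈ A) (hv' : v.2.2 ∈ A) :
    γ ^ 3 / 8 * (n : ℝ) ^ 6 ≤ #{x | IsGadget H x ∧ CanAbsorb H x v} := by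
  obtain ⟨hAdeg, hBdeg, hdeg, -, -⟩ := hAB
  have hn0 : (0 : ℝ) ≤ n := Nat.cast_nonneg _
  have hnn : 16 * (n : ℝ) ≤ γ * n ^ 2 := by nlinarith
  let S := link H v.1 ∩ B ×ˢ B
  have hS : γ / 2 * (n : ℝ) ^ 2 ≤ #S := by
    have h1 := le_card_link hH (by linarith) (hdeg v.1)
    have h2 := card_add_card_le_card_inter_add (link H v.1) (B ×ˢ B)
    rw [card_product] at h2
    push_cast at h2
    have h3 : (#(link H v.1 ∩ B ×ˢ B) : ℝ) = #S := rfl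
    nlinarith
  obtain ⟨E, hEmem, hE⟩ : ∃ E : Fin n → Fin n → Finset (Fin n) → Finset (Fin n × Fin n),
      (∀ y z R p, p ∈ E y z R ↔ ({y, p.1, p.2} ∈ H ∧ {z, p.1, p.2} ∈ H) ∧ p.1 ∉ R ∧ p.2 ∉ R) ∧
      ∀ y ∈ B, ∀ z ∈ A, ∀ R, #R ≤ 4 → γ / 2 * (n : ℝ) ^ 2 ≤ #(E y z R) := by
    refine ⟨fun y z R => {p ∈ link H y ∩ link H z | p.1 ∉ R ∧ p.2 ∉ R}, fun y z R p => ?_,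
      fun y hy z hz R hR => ?_⟩
    · simp [link]
    have h1 := le_card_link hH (by linarith) (hBdeg y hy)
    have h2 := le_card_link hH (by linarith) (hAdeg z hz)
    have h3 := card_add_card_le_card_inter_add (link H y) (link H z)
    have h4 := card_le_card_filter_avoid (link H y ∩ link H z) R
    have h5 : (#R : ℝ) ≤ 4 := by exact_mod_cast hR
    have h6 : 2 * #R * (n : ℝ) ≤ 2 * 4 * n := by gcongr
    linarith
  obtain ⟨Q, hQ⟩ : ∃ Q : Fin n × Fin n → (Fin n × Fin n) × Fin n × Fin n → Prop, ∀ u x, Q u x ↔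
      x.1 ∈ E u.1 v.2.1 {u.1, u.2} ∧ x.2 ∈ E u.2 v.2.2 {u.1, u.2, x.1.1, x.1.2} :=
    ⟨_, fun _ _ => Iff.rfl⟩
  have hpair : ∀ u ∈ S, γ / 2 * (n : ℝ) ^ 2 * (γ / 2 * (n : ℝ) ^ 2) ≤ #{x | Q u x} := by
    intro u hu
    have hu' := mem_product.1 (mem_inter.1 hu).2
    have h := mul_le_card_filter_product (E u.1 v.2.1 {u.1, u.2})
      (fun p q => q ∈ E u.2 v.2.2 {u.1, u.2, p.1, p.2}) (c := γ / 2 * (n : ℝ) ^ 2) fun p _ => by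
        rw [filter_mem_eq_inter, univ_inter]
        exact hE _ hu'.2 _ hv' _ card_le_four
    simp only [hQ]
    refine le_trans (mul_le_mul_of_nonneg_right
      (hE _ hu'.1 _ hv {u.1, u.2} (card_le_two.trans (by norm_num))) (by positivity)) ?_
    convert h
  have htotal := mul_le_card_filter_product S Q hpair
  have h1 : γ ^ 3 / 8 * (n : ℝ) ^ 6 ≤ #S * (γ / 2 * (n : ℝ) ^ 2 * (γ / 2 * (n : ℝ) ^ 2)) := by
    calc γ ^ 3 / 8 * (n : ℝ) ^ 6
        = γ / 2 * (n : ℝ) ^ 2 * (γ / 2 * (n : ℝ) ^ 2 * (γ / 2 * (n : ℝ) ^ 2)) := by ring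
      _ ≤ _ := mul_le_mul_of_nonneg_right hS (by positivity)
  refine (h1.trans htotal).trans ?_
  refine Nat.cast_le.2 (card_le_card fun x hx => ?_)
  simp only [mem_filter, mem_univ, true_and, S, mem_inter, link, hQ, hEmem, mem_insert,
      mem_singleton,
    not_or] at hx
  obtain ⟨⟨hv1, -⟩, ⟨⟨ha, ha'⟩, hb, hb'⟩, ⟨hc, hc'⟩, hd, hd'⟩ := hx
  have e1 := ne_of_mem_link hH hv1
  have e2 := ne_of_mem_link hH ha
  have e3 := ne_of_mem_link hH hc
  rw [mem_filter]
  refine ⟨mem_univ _, ⟨?_, ha, hc⟩, hv1, ha', hc'⟩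
  exact card_gadgetSupport e1 e2 e3 hb.1 hb.2 hb'.1 hb'.2 hd.1 hd.2.1 hd.2.2.1 hd.2.2.2
    hd'.1 hd'.2.1 hd'.2.2.1 hd'.2.2.2

lemma exists_disjoint_gadgets_pow {X V ι : Type} [DecidableEq X] [DecidableEq V] [Fintype ι]
    [Nonempty ι]
    (supp : X → Finset V) (𝒳 : Finset X) (𝒜 : ι → Finset X) {δ D N : ℝ} (hδ : 0 < δ)
    (hD : 0 ≤ D) (hN : 0 < N) (h𝒜 : ∀ i, 𝒜 i ⊆ 𝒳) (hsupp : ∀ x ∈ 𝒳, #(supp x) ≤ 6)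
    (hdeg : ∀ v, (#{x ∈ 𝒳 | v ∈ supp x} : ℝ) ≤ D) (hcard : ∀ i, δ * N ≤ #(𝒜 i))
    (h𝒳 : (#𝒳 : ℝ) ≤ N) (k : ℕ) (hk : 12 * k * D ≤ δ * N) :
    ∃ F : Fin k → X, (∀ j, F j ∈ 𝒳) ∧ (∀ i j, i ≠ j → Disjoint (supp (F i)) (supp (F j))) ∧
      ∀ i, (1 / 2 : ℝ) ^ #{j | F j ∈ 𝒜 i} ≤ Fintype.card ι * (1 - δ / 4) ^ k := by
  obtain ⟨F, hF, hFd, hΦ⟩ := exists_disjoint_gadgets supp 𝒳 𝒜 hδ hD hN h𝒜 hsupp hdeg hcard h𝒳 k hk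
  refine ⟨F, hF, hFd, fun i => le_trans (le_of_eq ?_) ((single_le_sum
    (f := fun i => ∏ j, (if F j ∈ 𝒜 i then 1 / 2 else 1 : ℝ))
    (fun i _ => prod_nonneg fun j _ => by split_ifs <;> norm_num) (mem_univ i)).trans hΦ)⟩
  rw [prod_ite, prod_const, prod_const_one, mul_one]

lemma mul_le_of_half_pow_le {δ κ θ : ℝ} {n c k : ℕ} (hδ0 : 0 < δ) (hδ1 : δ ≤ 1) (hκ0 : 0 < κ)
    (hθ : θ = δ * κ / 8) (hn0 : (0 : ℝ) < n) (hθn : 72 < θ ^ 4 * n) (hk' : κ * n < k + 1)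
    (h2 : (1 / 2 : ℝ) ^ c ≤ n ^ 3 * (1 - δ / 4) ^ k) : θ * n ≤ c := by
  have hθ0 : 0 < θ := hθ ▸ by positivity
  by_contra! hlt
  have h3 : Real.exp (-(θ * n)) ≤ (1 / 2 : ℝ) ^ c := by
    have h4 : Real.exp (-1) ≤ 1 / 2 := by
      rw [Real.exp_neg, one_div]
      have := Real.add_one_le_exp (1 : ℝ)
      gcongr
      linarith
    calc Real.exp (-(θ * n)) ≤ Real.exp (c * -1) := Real.exp_le_exp.2 (by linarith)
      _ = Real.exp (-1) ^ c := Real.exp_nat_mul _ _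
      _ ≤ _ := pow_le_pow_left₀ (Real.exp_pos _).le h4 c
  have h4 : (1 - δ / 4) ^ k ≤ Real.exp (1 - 2 * (θ * n)) := by
    have h5 : 1 - δ / 4 ≤ Real.exp (-(δ / 4)) := by
      have := Real.add_one_le_exp (-(δ / 4))
      linarith
    calc (1 - δ / 4) ^ k ≤ Real.exp (-(δ / 4)) ^ k := pow_le_pow_left₀ (by linarith) h5 k
      _ = Real.exp (k * -(δ / 4)) := (Real.exp_nat_mul _ _).symm
      _ ≤ _ := by
        refine Real.exp_le_exp.2 ?_
        rw [hθ]
        nlinarith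
  have h5 : Real.exp (θ * n) ≤ 3 * n ^ 3 := by
    have h6 : Real.exp (-(θ * n)) ≤ n ^ 3 * Real.exp (1 - 2 * (θ * n)) :=
      h3.trans (h2.trans (mul_le_mul_of_nonneg_left h4 (by positivity)))
    have h7 : Real.exp (2 * (θ * n)) * Real.exp (-(θ * n)) = Real.exp (θ * n) := by
      rw [← Real.exp_add]
      ring_nf
    have h8 : Real.exp (2 * (θ * n)) * Real.exp (1 - 2 * (θ * n)) = Real.exp 1 := by
      rw [← Real.exp_add]
      ring_nf
    have h9 := mul_le_mul_of_nonneg_left h6 (Real.exp_pos (2 * (θ * n))).le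
    rw [h7, mul_left_comm, h8] at h9
    have := Real.exp_one_lt_d9
    nlinarith [pow_pos hn0 3]
  have h6 := Real.pow_div_factorial_le_exp (θ * n) (by positivity) 4
  have h7 : (θ * n) ^ 4 ≤ 72 * n ^ 3 := by
    have : ((Nat.factorial 4 : ℕ) : ℝ) = 24 := by norm_num [Nat.factorial]
    rw [this, div_le_iff₀ (by norm_num)] at h6
    linarith
  have h8 : 72 * (n : ℝ) ^ 3 < θ ^ 4 * n * n ^ 3 := mul_lt_mul_of_pos_right hθn (by positivity)
  nlinarith

/-- A linear-size family of disjoint gadgets in which every triple has many absorbers. -/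
lemma exists_absorbing_family {γ α : ℝ} (hγ0 : 0 < γ) (hγ : γ ≤ 1) (hα : 0 < α) :
    ∃ β : ℝ, 0 < β ∧ ∃ n₀ : ℕ, ∀ n ≥ n₀, ∀ H : Finset (Finset (Fin n)), Is3Graph n H →
      ∀ A B : Finset (Fin n), DegreeCondition γ H A B → 2 / 3 * (n : ℝ) ^ 2 ≤ (#B : ℝ) ^ 2 →
      ∃ (k : ℕ) (F : Fin k → (Fin n × Fin n) × (Fin n × Fin n) × Fin n × Fin n), k ≤ α * n ∧
        (∀ j, IsGadget H (F j)) ∧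
        (∀ i j, i ≠ j → Disjoint (gadgetSupport (F i)) (gadgetSupport (F j))) ∧
        ∀ v : Fin n × Fin n × Fin n, v.2.1 ∈ A → v.2.2 ∈ A →
          β * n ≤ #{j | CanAbsorb H (F j) v} := by
  obtain ⟨δ, hδ⟩ : ∃ δ, δ = γ ^ 3 / 8 := ⟨_, rfl⟩
  have hδ0 : 0 < δ := hδ ▸ by positivity
  have hδ1 : δ ≤ 1 := by
    have : γ ^ 3 ≤ 1 := pow_le_one₀ hγ0.le hγ
    linarith
  obtain ⟨κ, hκ0, hκα, hκδ⟩ : ∃ κ : ℝ, 0 < κ ∧ κ ≤ α ∧ 72 * κ ≤ δ :=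
    ⟨min α (δ / 72), lt_min hα (by positivity), min_le_left _ _, by
      have := min_le_right α (δ / 72); linarith⟩
  obtain ⟨θ, hθ⟩ : ∃ θ, θ = δ * κ / 8 := ⟨_, rfl⟩
  have hθ0 : 0 < θ := hθ ▸ by positivity
  obtain ⟨n₁, hn₁⟩ := exists_nat_gt (16 / γ)
  obtain ⟨n₂, hn₂⟩ := exists_nat_gt (72 / θ ^ 4)
  refine ⟨θ, hθ0, max n₁ n₂, fun n hn H hH A B hAB hB => ?_⟩
  have hnn₁ : (n₁ : ℝ) ≤ n := by exact_mod_cast (le_max_left n₁ n₂).trans hn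
  have hnn₂ : (n₂ : ℝ) ≤ n := by exact_mod_cast (le_max_right n₁ n₂).trans hn
  have hγn : 16 ≤ γ * n := by rw [div_lt_iff₀ hγ0] at hn₁; nlinarith
  have hθn : 72 < θ ^ 4 * n := by
    rw [div_lt_iff₀ (by positivity)] at hn₂
    have := mul_le_mul_of_nonneg_right hnn₂ (pow_pos hθ0 4).le
    linarith
  have hn0 : (0 : ℝ) < n := pos_of_mul_pos_right (by linarith : 0 < γ * n) hγ0.le
  let ι := {v : Fin n × Fin n × Fin n // v.2.1 ∈ A ∧ v.2.2 ∈ A}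
  have hι : Nonempty ι := by
    have h1 : A.Nonempty := by
      rw [nonempty_iff_ne_empty]
      rintro rfl
      have := hAB.2.2.2.1
      rw [compl_empty, card_univ, Fintype.card_fin] at this
      linarith
    obtain ⟨a, ha⟩ := h1
    exact ⟨⟨(a, a, a), ha, ha⟩⟩
  have hιn : (Fintype.card ι : ℝ) ≤ n ^ 3 := by
    have : Fintype.card ι ≤ n * (n * n) := by
      refine (Fintype.card_subtype_le _).trans (le_of_eq ?_)
      simp
    have : (Fintype.card ι : ℝ) ≤ n * (n * n) := by exact_mod_cast this
    linarith
  obtain ⟨k, hk, hk'⟩ : ∃ k : ℕ, (k : ℝ) ≤ κ * n ∧ κ * n < k + 1 :=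
    ⟨⌊κ * n⌋₊, Nat.floor_le (by positivity), Nat.lt_floor_add_one _⟩
  obtain ⟨F, hF, hFd, hΦ⟩ := exists_disjoint_gadgets_pow (ι := ι) gadgetSupport
    ({x | IsGadget H x} : Finset ((Fin n × Fin n) × (Fin n × Fin n) × Fin n × Fin n))
    (fun i => {x | IsGadget H x ∧ CanAbsorb H x i.1}) hδ0 (D := 6 * (n : ℝ) ^ 5)
    (N := (n : ℝ) ^ 6) (by positivity) (by positivity)
    (fun i x hx => by
      rw [mem_filter] at hx ⊢
      exact ⟨hx.1, hx.2.1⟩)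
    (fun x hx => (mem_filter.1 hx).2.1.le) (card_gadgets_containing_le _)
    (fun i => hδ ▸ le_card_absorbers hH hγ0 hγ hγn hAB hB i.1 i.2.1 i.2.2)
    (by
      have h1 : #({x | IsGadget H x} : Finset ((Fin n × Fin n) × (Fin n × Fin n) × Fin n × Fin n))
          ≤ n ^ 6 := by
        refine (card_le_univ _).trans (le_of_eq ?_)
        simp only [Fintype.card_prod, Fintype.card_fin]
        ring
      exact_mod_cast h1) k
    (by
      have h1 : 72 * (k : ℝ) ≤ δ * n := by nlinarith
      have h2 := mul_le_mul_of_nonneg_right h1 (pow_nonneg hn0.le 5)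
      calc 12 * (k : ℝ) * (6 * (n : ℝ) ^ 5) = 72 * k * n ^ 5 := by ring
        _ ≤ δ * n * n ^ 5 := h2
        _ = _ := by ring)
  refine ⟨k, F, hk.trans (mul_le_mul_of_nonneg_right hκα hn0.le),
    fun j => (mem_filter.1 (hF j)).2, hFd, fun v hv hv' => ?_⟩
  refine mul_le_of_half_pow_le hδ0 hδ1 hκ0 hθ hn0 hθn hk' ?_
  have h := (hΦ ⟨v, hv, hv'⟩).trans
    (mul_le_mul_of_nonneg_right hιn (pow_nonneg (by linarith) _))
  refine le_trans (le_of_eq (congrArg _ (congrArg card ?_))) h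
  ext j
  rw [mem_filter, mem_filter, mem_filter]
  exact ⟨fun hj => ⟨hj.1, mem_univ _, (mem_filter.1 (hF j)).2, hj.2⟩, fun hj => ⟨hj.1, hj.2.2.2⟩⟩

lemma isPerfectMatching_of_cover_eq {n : ℕ} {H M : Finset (Finset (Fin n))} (hH : Is3Graph n H)
    (hM : M ⊆ H) (hc : cover M = univ) (hcard : 3 * #M ≤ n) : IsPerfectMatching H M := by
  refine ⟨⟨hM, fun e he f hf hef => ?_⟩, hc⟩
  by_contra hd
  obtain ⟨v, hve, hvf⟩ := not_disjoint_iff.1 hd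
  have h1 : e ∪ cover (M.erase e) = univ := by
    rw [← hc, cover, cover]
    nth_rw 2 [← insert_erase he]
    rw [biUnion_insert, id]
  have h2 : #(cover (M.erase e)) ≤ #(M.erase e) * 3 := card_biUnion_le_card_mul _ _ _ fun f hf =>
    (hH f (hM (mem_of_mem_erase hf))).le
  have h3 : v ∈ e ∩ cover (M.erase e) :=
    mem_inter.2 ⟨hve, mem_biUnion.2 ⟨f, mem_erase.2 ⟨hef.symm, hf⟩, hvf⟩⟩
  have h4 := card_pos.2 ⟨v, h3⟩
  have h5 := card_union_add_card_inter e (cover (M.erase e))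
  rw [h1, card_univ, Fintype.card_fin, hH e (hM he)] at h5
  have h6 := card_erase_add_one he
  omega

lemma exists_isPerfectMatching_of_absorb {n k q : ℕ} {H M : Finset (Finset (Fin n))}
    (hH : Is3Graph n H) (hM : M ⊆ H)
    (F : Fin k → (Fin n × Fin n) × (Fin n × Fin n) × Fin n × Fin n) (hF : ∀ j, IsGadget H (F j))
    (T : Fin q → Fin n × Fin n × Fin n) (φ : Fin q → Fin k) (hφ : Function.Injective φ)
    (hT : ∀ i, CanAbsorb H (F (φ i)) (T i))
    (hcover : ∀ v, v ∈ cover M ∨ (∃ j, v ∈ gadgetSupport (F j)) ∨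
      ∃ i, v = (T i).1 ∨ v = (T i).2.1 ∨ v = (T i).2.2)
    (hcard : 3 * #M + 6 * k + 3 * q ≤ n) : ∃ M, IsPerfectMatching H M := by
  let E₀ : Fin k → Finset (Finset (Fin n)) := fun j =>
    {{(F j).1.1, (F j).2.1.1, (F j).2.1.2}, {(F j).1.2, (F j).2.2.1, (F j).2.2.2}}
  let E₁ : Fin q → Finset (Finset (Fin n)) := fun i =>
    {{(T i).1, (F (φ i)).1.1, (F (φ i)).1.2}, {(T i).2.1, (F (φ i)).2.1.1, (F (φ i)).2.1.2},
      {(T i).2.2, (F (φ i)).2.2.1, (F (φ i)).2.2.2}}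
  let I : Finset (Fin k) := univ.image φ
  have hI : #I = q := by rw [card_image_of_injective _ hφ, card_univ, Fintype.card_fin]
  have hIc : #I + #Iᶜ = k := by rw [card_add_card_compl, Fintype.card_fin]
  let M' := M ∪ (Iᶜ.biUnion E₀ ∪ univ.biUnion E₁)
  have hmem : ∀ {e v}, e ∈ M' → v ∈ e → v ∈ cover M' := fun he hv =>
    mem_biUnion.2 ⟨_, he, hv⟩
  refine ⟨M', isPerfectMatching_of_cover_eq hH ?_ ?_ ?_⟩
  · refine union_subset hM (union_subset ?_ ?_)
    · refine biUnion_subset.2 fun j _ e he => ?_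
      rw [mem_insert, mem_singleton] at he
      rcases he with rfl | rfl
      exacts [(hF j).2.1, (hF j).2.2]
    · refine biUnion_subset.2 fun i _ e he => ?_
      rw [mem_insert, mem_insert, mem_singleton] at he
      rcases he with rfl | rfl | rfl
      exacts [(hT i).1, (hT i).2.1, (hT i).2.2]
  · refine eq_univ_of_forall fun v => ?_
    have hE₁ : ∀ i, ∀ e ∈ E₁ i, e ∈ M' := fun i e he =>
      mem_union_right _ (mem_union_right _ (mem_biUnion.2 ⟨i, mem_univ _, he⟩))
    have hE₁a : ∀ i v, v ∈ ({(T i).1, (F (φ i)).1.1, (F (φ i)).1.2} : Finset (Fin n)) →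
        v ∈ cover M' := fun i v hv => hmem (hE₁ i _ (by simp [E₁])) hv
    have hE₁b : ∀ i v, v ∈ ({(T i).2.1, (F (φ i)).2.1.1, (F (φ i)).2.1.2} : Finset (Fin n)) →
        v ∈ cover M' := fun i v hv => hmem (hE₁ i _ (by simp [E₁])) hv
    have hE₁c : ∀ i v, v ∈ ({(T i).2.2, (F (φ i)).2.2.1, (F (φ i)).2.2.2} : Finset (Fin n)) →
        v ∈ cover M' := fun i v hv => hmem (hE₁ i _ (by simp [E₁])) hv
    rcases hcover v with hv | ⟨j, hj⟩ | ⟨i, rfl | rfl | rfl⟩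
    · obtain ⟨e, he, hve⟩ := mem_biUnion.1 hv
      exact hmem (mem_union_left _ he) hve
    · simp only [gadgetSupport, mem_insert, mem_singleton] at hj
      by_cases hjI : j ∈ I
      · obtain ⟨i, -, rfl⟩ := mem_image.1 hjI
        rcases hj with h | h | h | h | h | h
        · exact hE₁a i v (by simp [h])
        · exact hE₁a i v (by simp [h])
        · exact hE₁b i v (by simp [h])
        · exact hE₁b i v (by simp [h])
        · exact hE₁c i v (by simp [h])
        · exact hE₁c i v (by simp [h])
      · have hE₀ : ∀ e ∈ E₀ j, e ∈ M' := fun e he =>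
          mem_union_right _ (mem_union_left _ (mem_biUnion.2 ⟨j, mem_compl.2 hjI, he⟩))
        have ha : ∀ v ∈ ({(F j).1.1, (F j).2.1.1, (F j).2.1.2} : Finset (Fin n)), v ∈ cover M' :=
          fun v hv => hmem (hE₀ _ (by simp [E₀])) hv
        have hb : ∀ v ∈ ({(F j).1.2, (F j).2.2.1, (F j).2.2.2} : Finset (Fin n)), v ∈ cover M' :=
          fun v hv => hmem (hE₀ _ (by simp [E₀])) hv
        rcases hj with h | h | h | h | h | h
        · exact ha v (by simp [h])
        · exact hb v (by simp [h])
        · exact ha v (by simp [h])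
        · exact ha v (by simp [h])
        · exact hb v (by simp [h])
        · exact hb v (by simp [h])
    · exact hE₁a i _ (mem_insert_self _ _)
    · exact hE₁b i _ (mem_insert_self _ _)
    · exact hE₁c i _ (mem_insert_self _ _)
  · have h1 : #M' ≤ #M + (#(Iᶜ.biUnion E₀) + #(univ.biUnion E₁)) :=
      (card_union_le _ _).trans (Nat.add_le_add_left (card_union_le _ _) _)
    have h2 : #(Iᶜ.biUnion E₀) ≤ #Iᶜ * 2 := card_biUnion_le_card_mul _ _ _ fun _ _ => card_le_two
    have h3 : #((univ : Finset (Fin q)).biUnion E₁) ≤ #(univ : Finset (Fin q)) * 3 :=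
      card_biUnion_le_card_mul _ _ _ fun _ _ => card_le_three
    rw [card_univ, Fintype.card_fin] at h3
    omega

lemma exists_triples {V : Type} [DecidableEq V] {W S : Finset V} {q : ℕ} (hW : #W = 3 * q)
    (hSW : S ⊆ W) (hS : 2 * q ≤ #S) : ∃ T : Fin q → V × V × V,
      (∀ i, (T i).2.1 ∈ S ∧ (T i).2.2 ∈ S) ∧
      ∀ w ∈ W, ∃ i, w = (T i).1 ∨ w = (T i).2.1 ∨ w = (T i).2.2 := by
  obtain ⟨P, hPS, hP⟩ := exists_subset_card_eq hS
  have hWP : #(W \ P) = q := by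
    rw [card_sdiff_of_subset (hPS.trans hSW)]
    omega
  let e : Fin q ≃ (W \ P : Finset V) := Fintype.equivOfCardEq (by simp [hWP])
  let f : Fin q × Fin 2 ≃ P := Fintype.equivOfCardEq (by simp [hP, mul_comm])
  refine ⟨fun i => (e i, f (i, 0), f (i, 1)), fun i => ⟨hPS (f (i, 0)).2, hPS (f (i, 1)).2⟩,
    fun w hw => ?_⟩
  by_cases hwP : w ∈ P
  · obtain ⟨⟨i, b⟩, hib⟩ := f.surjective ⟨w, hwP⟩
    refine ⟨i, Or.inr ?_⟩
    have hib' : w = (f (i, b) : V) := by rw [hib]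
    fin_cases b
    · exact Or.inl hib'
    · exact Or.inr hib'
  · obtain ⟨i, hi⟩ := e.surjective ⟨w, mem_sdiff.2 ⟨hw, hwP⟩⟩
    exact ⟨i, Or.inl (by simp [hi])⟩

lemma exists_perfectMatching_of_degreeCondition {γ : ℝ} (hγ0 : 0 < γ) (hγ : γ ≤ 1) :
    ∃ n₀ : ℕ, ∀ n ≥ n₀, 3 ∣ n → ∀ H : Finset (Finset (Fin n)), Is3Graph n H →
      ∀ A B : Finset (Fin n), DegreeCondition γ H A B → 2 / 3 * (n : ℝ) ^ 2 ≤ (#B : ℝ) ^ 2 →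
      ∃ M, IsPerfectMatching H M := by
  obtain ⟨η, hη0, hηγ, hη⟩ : ∃ η : ℝ, 0 < η ∧ 16 * η ≤ γ ∧ η ≤ 1 / 10000 :=
    ⟨min (γ / 16) (1 / 10000), by positivity, by
      have := min_le_left (γ / 16) (1 / 10000); linarith, min_le_right _ _⟩
  obtain ⟨β, hβ0, n₁, hn₁⟩ := exists_absorbing_family hγ0 hγ (α := η / 12) (by positivity)
  obtain ⟨ε, hε0, hεη, hεβ⟩ : ∃ ε : ℝ, 0 < ε ∧ 8 * ε ≤ η ∧ ε ≤ β :=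
    ⟨min (η / 8) β, by positivity, by have := min_le_left (η / 8) β; linarith, min_le_right _ _⟩
  obtain ⟨n₂, hn₂⟩ := exists_almost_perfect_matching hγ hη0 hηγ hη hε0
  refine ⟨max n₁ n₂, fun n hn h3 H hH A B hAB hB => ?_⟩
  have hn0 : (0 : ℝ) ≤ n := Nat.cast_nonneg _
  obtain ⟨k, F, hk, hF, hFd, habs⟩ := hn₁ n ((le_max_left _ _).trans hn) H hH A B hAB hB
  let U := univ.biUnion fun j => gadgetSupport (F j)
  have hU : #U = 6 * k := by
    rw [card_biUnion fun i _ j _ hij => hFd i j hij, sum_congr rfl fun j _ => (hF j).1, sum_const,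
      card_univ, Fintype.card_fin, smul_eq_mul, mul_comm]
  obtain ⟨s, hs, hs'⟩ : ∃ s : ℕ, (s : ℝ) ≤ ε * n ∧ ε * n < s + 1 :=
    ⟨⌊ε * n⌋₊, Nat.floor_le (by positivity), Nat.lt_floor_add_one _⟩
  have hηn : η * n ≤ 1 / 10000 * n := mul_le_mul_of_nonneg_right hη hn0
  have hεn : 8 * (ε * n) ≤ η * n := by
    rw [← mul_assoc]
    exact mul_le_mul_of_nonneg_right hεη hn0
  have hAU : 2 * s ≤ #(A \ U) := by
    have h1 : #A ≤ #(A \ U) + #U := by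
      have := le_card_sdiff U A
      omega
    have h2 : #A + #Aᶜ = n := by rw [card_add_card_compl, Fintype.card_fin]
    have h3 : (#A : ℝ) + #Aᶜ = n := by exact_mod_cast h2
    have h4 : (#A : ℝ) ≤ #(A \ U) + 6 * k := by exact_mod_cast hU ▸ h1
    have h5 := hAB.2.2.2.1
    have : (2 * s : ℝ) ≤ #(A \ U) := by linarith
    exact_mod_cast this
  obtain ⟨S, hSA, hS⟩ := exists_subset_card_eq hAU
  have hUS : Disjoint U S := disjoint_left.2 fun v hv hvS => (mem_sdiff.1 (hSA hvS)).2 hv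
  have hD : #(U ∪ S) = 6 * k + 2 * s := by rw [card_union_of_disjoint hUS, hU, hS]
  obtain ⟨M, hMH, hMD, hMc, hML⟩ := hn₂ n ((le_max_right _ _).trans hn) H hH A B (U ∪ S) hAB (by
    rw [hD]
    push_cast
    linarith)
  obtain ⟨R, hR⟩ : ∃ R, R = (cover M ∪ (U ∪ S))ᶜ := ⟨_, rfl⟩
  rw [← hR] at hML
  have hRs : #R ≤ s := by
    have : (#R : ℝ) < (s + 1 : ℕ) := by
      push_cast
      linarith
    exact Nat.lt_succ_iff.1 (by exact_mod_cast this)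
  have hRn : 3 * #M + (6 * k + 2 * s) + #R = n := by
    have h1 : #(cover M ∪ (U ∪ S)) + #(cover M ∪ (U ∪ S))ᶜ = Fintype.card (Fin n) :=
      card_add_card_compl _
    rw [← hR, card_union_of_disjoint hMD, hMc, hD, Fintype.card_fin] at h1
    exact h1
  have hRS : #(R ∪ S) = #R + 2 * s := by
    rw [card_union_of_disjoint, hS]
    rw [hR, disjoint_left]
    intro v hv hvS
    exact mem_compl.1 hv (mem_union_right _ (mem_union_right _ hvS))
  obtain ⟨q, hq⟩ : ∃ q, #(R ∪ S) = 3 * q := by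
    obtain ⟨m, hm⟩ := h3
    exact ⟨m - #M - 2 * k, by omega⟩
  obtain ⟨T, hTS, hT⟩ := exists_triples hq subset_union_right (by omega)
  have hTA : ∀ i, (T i).2.1 ∈ A ∧ (T i).2.2 ∈ A := fun i =>
    ⟨(mem_sdiff.1 (hSA (hTS i).1)).1, (mem_sdiff.1 (hSA (hTS i).2)).1⟩
  let t : Fin q → Finset (Fin k) := fun i => {j | CanAbsorb H (F j) (T i)}
  have ht : ∀ i, q ≤ #(t i) := by
    intro i
    have h1 : β * n ≤ #(t i) := habs (T i) (hTA i).1 (hTA i).2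
    have h2 : q ≤ s := by omega
    have h3 : (q : ℝ) ≤ s := by exact_mod_cast h2
    have h4 : ε * n ≤ β * n := mul_le_mul_of_nonneg_right hεβ hn0
    have : (q : ℝ) ≤ #(t i) := by linarith
    exact_mod_cast this
  obtain ⟨φ, hφ, hφt⟩ := (all_card_le_biUnion_card_iff_exists_injective t).1 (by
    intro J
    rcases J.eq_empty_or_nonempty with rfl | ⟨i, hi⟩
    · simp
    · exact ((card_le_univ J).trans (by simpa using ht i)).trans
        (card_le_card (subset_biUnion_of_mem t hi)))
  refine exists_isPerfectMatching_of_absorb hH hMH F hF T φ hφ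
    (fun i => (mem_filter.1 (hφt i)).2) (fun v => ?_) (by omega)
  by_cases hv : v ∈ R ∪ S
  · exact Or.inr (Or.inr (hT v hv))
  · rw [mem_union, not_or, hR, mem_compl, not_not, mem_union, mem_union] at hv
    rcases hv.1 with h | h | h
    · exact Or.inl h
    · obtain ⟨j, -, hj⟩ := mem_biUnion.1 h
      exact Or.inr (Or.inl ⟨j, hj⟩)
    · exact absurd h hv.2

lemma card_compl_le_of_forall_index {n m : ℕ} (σ : Fin n ≃ Fin n) {S : Finset (Fin n)}
    (h : ∀ i, σ i ∉ S → (i : ℕ) < m) : #Sᶜ ≤ m := by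
  refine (card_le_card_of_injOn (t := range m) (fun v => (σ.symm v : ℕ)) (fun v hv => ?_)
    fun v _ w _ hvw => σ.symm.injective (Fin.ext hvw)).trans_eq (card_range m)
  rw [mem_coe, mem_range]
  refine h _ ?_
  rw [Equiv.apply_symm_apply]
  exact mem_compl.1 hv

/-- Main theorem: for all `γ > 0` there exists `n₀` such that for every `n ≥ n₀` with
`3 ∣ n` and every `t` with `1 ≤ t ≤ (1 − √(2/3))·n` the following holds.  If `H` is a
`3`-graph on `n` vertices with degree sequence `d₁ ≤ … ≤ dₙ` (witnessed by a monotone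
ordering `σ` of the vertices, vertex in position `i` having degree `dᵢ`) satisfying
`dᵢ ≥ (1/3 + γ)·C(n,2) + i·t` for `1 ≤ i ≤ t`,
`dᵢ ≥ (4/9 + γ)·C(n,2)` for `t < i ≤ n/3`, and
`dᵢ ≥ (5/9 + γ)·C(n,2)` for `i > n/3`,
then `H` contains a perfect matching. -/
theorem degree_sequence_perfect_matching (γ : ℝ) (hγ : 0 < γ) :
    ∃ n₀ : ℕ, ∀ n : ℕ, n₀ ≤ n → 3 ∣ n →
      ∀ t : ℕ, 1 ≤ t → (t : ℝ) ≤ (1 - Real.sqrt (2/3)) * n →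
      ∀ H : Finset (Finset (Fin n)), Is3Graph n H →
      (∃ σ : Fin n ≃ Fin n, Monotone (fun i => deg H (σ i)) ∧
        ∀ i : Fin n,
          ((i : ℕ) + 1 ≤ t →
            ((1 : ℝ)/3 + γ) * (n.choose 2) + ((i : ℕ) + 1) * t ≤ (deg H (σ i) : ℝ)) ∧
          (t < (i : ℕ) + 1 → 3 * ((i : ℕ) + 1) ≤ n →
            ((4 : ℝ)/9 + γ) * (n.choose 2) ≤ (deg H (σ i) : ℝ)) ∧
          (n < 3 * ((i : ℕ) + 1) →
            ((5 : ℝ)/9 + γ) * (n.choose 2) ≤ (deg H (σ i) : ℝ))) →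
      ∃ M, IsPerfectMatching H M := by
  obtain ⟨γ', hγ'0, hγ'1, hγ'⟩ : ∃ γ' : ℝ, 0 < γ' ∧ γ' ≤ 1 ∧ γ' ≤ γ :=
    ⟨min γ 1, by positivity, min_le_right _ _, min_le_left _ _⟩
  obtain ⟨n₀, hn₀⟩ := exists_perfectMatching_of_degreeCondition hγ'0 hγ'1
  refine ⟨n₀, fun n hn h3 t _ ht H hH ⟨σ, _, hσ⟩ => ?_⟩
  have hC : (0 : ℝ) ≤ n.choose 2 := Nat.cast_nonneg _
  have hn0 : (0 : ℝ) ≤ n := Nat.cast_nonneg _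
  have hγC : γ' * (n.choose 2 : ℝ) ≤ γ * n.choose 2 := mul_le_mul_of_nonneg_right hγ' hC
  let A : Finset (Fin n) := {v | (5 / 9 + γ') * (n.choose 2) ≤ (deg H v : ℝ)}
  let B : Finset (Fin n) := {v | (4 / 9 + γ') * (n.choose 2) ≤ (deg H v : ℝ)}
  have hA : #Aᶜ ≤ n / 3 := card_compl_le_of_forall_index σ fun i hi => by
    by_contra! hlt
    refine hi (mem_filter.2 ⟨mem_univ _, ?_⟩)
    have := (hσ i).2.2 (by omega)
    linarith
  have hB : #Bᶜ ≤ t := card_compl_le_of_forall_index σ fun i hi => by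
    by_contra! hlt
    refine hi (mem_filter.2 ⟨mem_univ _, ?_⟩)
    rcases le_or_gt (3 * ((i : ℕ) + 1)) n with h | h
    · have := (hσ i).2.1 (by omega) h
      linarith
    · have := (hσ i).2.2 h
      linarith
  have hBt : (#Bᶜ : ℝ) ≤ t := by exact_mod_cast hB
  have hall : ∀ v, (3 / 9 + γ') * (n.choose 2) ≤ (deg H v : ℝ) := by
    intro v
    obtain ⟨i, rfl⟩ := σ.surjective v
    by_cases h1 : (i : ℕ) + 1 ≤ t
    · have := (hσ i).1 h1
      have : (0 : ℝ) ≤ ((i : ℕ) + 1) * t := by positivity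
      linarith
    · rcases le_or_gt (3 * ((i : ℕ) + 1)) n with h | h
      · have := (hσ i).2.1 (by omega) h
        linarith
      · have := (hσ i).2.2 h
        linarith
  have hsqrt : (0.81649 : ℝ) ≤ √(2 / 3) := Real.le_sqrt_of_sq_le (by norm_num)
  refine hn₀ n hn h3 H hH A B ⟨fun v hv => (mem_filter.1 hv).2, fun v hv => (mem_filter.1 hv).2,
    hall, ?_, ?_⟩ ?_
  · have : 3 * #Aᶜ ≤ n := by omega
    exact_mod_cast this
  · refine (hBt.trans ht).trans (mul_le_mul_of_nonneg_right ?_ hn0)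
    linarith
  · have h1 : #B + #Bᶜ = n := by rw [card_add_card_compl, Fintype.card_fin]
    have h2 : (#B : ℝ) + #Bᶜ = n := by exact_mod_cast h1
    have h3 : √(2 / 3) * n ≤ #B := by linarith
    calc 2 / 3 * (n : ℝ) ^ 2 = (√(2 / 3) * n) ^ 2 := by
          rw [mul_pow, Real.sq_sqrt (by norm_num)]
      _ ≤ _ := pow_le_pow_left₀ (by positivity) h3 2
end
end

section
/- Let n ∈ ℕ be divisible by 3 with n/3 odd, and let H be the 3-graph whose vertex set is the disjoint union A ∪ B with |A| = n/3 and |B| = 2n/3, and whose edges are exactly the 3-element subsets containing an even number of vertices from A (i.e. 0 or 2 vertices of A). Then every vertex v ∈ A has degree deg(v) = (n/3 − 1)·(2n/3) = (4/9)·C(n,2) − 4n/9, and H contains no perfect matching. -/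
open Finset
open scoped Classical

noncomputable section

/-- The part `A` of the parity barrier: the first `n/3` vertices. -/
def parityA (n : ℕ) : Finset (Fin n) :=
  univ.filter fun v => (v : ℕ) < n / 3

/-- The parity-barrier `3`-graph: all `3`-element subsets containing an even number
(0 or 2) of vertices from `A`. -/
def parityH (n : ℕ) : Finset (Finset (Fin n)) :=
  (univ.powersetCard 3).filter fun e => Even ((e ∩ parityA n).card)

theorem card_parityA (n : ℕ) : (parityA n).card = n / 3 := by
  have h : (Finset.univ.filter fun v : Fin n => (v : ℕ) < n / 3).card = min n (n / 3) := by
    simp [Fin.card_filter_val_lt]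
  rw [parityA]
  convert h using 1
  omega

theorem parityH_filter_mem_eq_image (n : ℕ) {v : Fin n} (hv : v ∈ parityA n) :
    ((parityH n).filter fun e => v ∈ e) =
      ((parityA n).erase v ×ˢ (parityA n)ᶜ).image fun p => ({v, p.1, p.2} : Finset (Fin n)) := by
  ext e
  simp only [parityH, mem_filter, mem_powersetCard, mem_image, mem_product, mem_erase, mem_compl,
    Prod.exists]
  constructor
  · rintro ⟨⟨⟨-, hc⟩, heven⟩, hve⟩
    have hvA : v ∈ e ∩ parityA n := mem_inter.2 ⟨hve, hv⟩
    have hpos : 0 < (e ∩ parityA n).card := card_pos.2 ⟨v, hvA⟩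
    have hsum := card_inter_add_card_sdiff e (parityA n)
    have htwo : (e ∩ parityA n).card = 2 := by
      obtain ⟨k, hk⟩ := heven
      omega
    have herase : ((e ∩ parityA n).erase v).card = 1 := by
      rw [card_erase_of_mem hvA, htwo]
    obtain ⟨a, ha⟩ := card_eq_one.1 herase
    obtain ⟨b, hb⟩ := card_eq_one.1 (show (e \ parityA n).card = 1 by omega)
    have ha' : a ∈ (e ∩ parityA n).erase v := by simp [ha]
    have hb' : b ∈ e \ parityA n := by simp [hb]
    simp only [mem_erase, mem_inter] at ha'
    simp only [mem_sdiff] at hb'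
    refine ⟨a, b, ⟨⟨ha'.1, ha'.2.2⟩, hb'.2⟩, ?_⟩
    rw [← sdiff_union_inter e (parityA n), ← insert_erase hvA, ha, hb]
    ext x
    simp only [mem_insert, mem_singleton, mem_union]
    tauto
  · rintro ⟨a, b, ⟨⟨hav, ha⟩, hb⟩, rfl⟩
    have hvb : v ≠ b := fun h => hb (h ▸ hv)
    have hab : a ≠ b := fun h => hb (h ▸ ha)
    refine ⟨⟨⟨subset_univ _, card_eq_three.2 ⟨v, a, b, hav.symm, hvb, hab, rfl⟩⟩, ?_⟩, by simp⟩
    have hinter : ({v, a, b} : Finset (Fin n)) ∩ parityA n = {v, a} := by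
      rw [insert_inter_of_mem hv, insert_inter_of_mem ha, singleton_inter_of_notMem hb,
        insert_empty_eq]
    rw [hinter, card_pair hav.symm]
    exact even_two

theorem deg_parityH (n : ℕ) {v : Fin n} (hv : v ∈ parityA n) :
    deg (parityH n) v = (n / 3 - 1) * (n - n / 3) := by
  rw [deg, parityH_filter_mem_eq_image n hv, card_image_of_injOn, card_product,
    card_erase_of_mem hv, card_compl, card_parityA, Fintype.card_fin]
  rintro ⟨a, b⟩ hab ⟨c, d⟩ hcd h
  simp only [mem_coe, mem_product, mem_erase, mem_compl] at hab hcd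
  obtain ⟨⟨hav, ha⟩, hb⟩ := hab
  obtain ⟨⟨-, hc⟩, hd⟩ := hcd
  replace h : ({v, a, b} : Finset (Fin n)) = {v, c, d} := h
  have h₁ : a ∈ ({v, c, d} : Finset (Fin n)) := by
    simp [← h]
  have h₂ : b ∈ ({v, c, d} : Finset (Fin n)) := by
    simp [← h]
  simp only [mem_insert, mem_singleton] at h₁ h₂
  have hac : a = c := by
    rcases h₁ with h | h | h
    · exact absurd h hav
    · exact h
    · exact absurd (h ▸ ha) hd
  have hbd : b = d := by
    rcases h₂ with h | h | h
    · exact absurd (h ▸ hv) hb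
    · exact absurd (h ▸ hc) hb
    · exact h
  rw [hac, hbd]

/-- A set meeting every edge in an even number of vertices has even size whenever a perfect
matching exists. -/
theorem IsPerfectMatching.even_card {n : ℕ} {H M : Finset (Finset (Fin n))}
    (hM : IsPerfectMatching H M) (S : Finset (Fin n)) (hS : ∀ e ∈ H, Even (e ∩ S).card) :
    Even S.card := by
  obtain ⟨⟨hMH, hdisj⟩, hcover⟩ := hM
  have hS_eq : S = M.biUnion fun e => e ∩ S := by
    rw [← biUnion_inter]
    change S = cover M ∩ S
    rw [hcover, univ_inter]
  rw [hS_eq, card_biUnion fun e he f hf hef =>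
    (hdisj e he f hf hef).mono inter_subset_left inter_subset_left]
  exact even_sum _ fun e he => hS e (hMH he)

/-- Extremal example 2 (parity barrier): for `n` divisible by `3` with `n/3` odd, in the
`3`-graph on `A ∪ B` with `|A| = n/3`, `|B| = 2n/3` whose edges are the triples with an
even number of vertices in `A`, every vertex of `A` has degree
`(n/3 − 1)·(2n/3) = (4/9)·C(n,2) − 4n/9`, and there is no perfect matching. -/
theorem parity_barrier (n : ℕ) (hn3 : 3 ∣ n) (hodd : Odd (n / 3)) :
    (∀ v ∈ parityA n,
      deg (parityH n) v = (n / 3 - 1) * (2 * n / 3) ∧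
      (deg (parityH n) v : ℝ) = (4 : ℝ)/9 * (n.choose 2) - 4 * (n : ℝ)/9) ∧
    ¬ ∃ M, IsPerfectMatching (parityH n) M := by
  refine ⟨fun v hv => ?_, ?_⟩
  · rw [deg_parityH n hv]
    obtain ⟨m, rfl⟩ := hn3
    have hm : 3 * m / 3 = m := by omega
    rw [hm] at hodd ⊢
    have hpos : 1 ≤ m := hodd.pos
    have hsub : 3 * m - m = 2 * m := by omega
    have hdiv : 2 * (3 * m) / 3 = 2 * m := by omega
    rw [hsub, hdiv]
    refine ⟨rfl, ?_⟩
    rw [Nat.cast_choose_two]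
    push_cast [Nat.cast_sub hpos]
    ring
  · rintro ⟨M, hM⟩
    have heven := hM.even_card (parityA n) fun e he => (mem_filter.1 he).2
    rw [card_parityA] at heven
    exact Nat.not_even_iff_odd.2 hodd heven
end
end
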